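/- arXiv:2001.08315 — 4 statements merged into one kernel-verified Lean document; each statement's English description precedes it below -/
import Mathlib

section
/- For every γ ≥ 1 there exists g₀ such that for all g ≥ g₀ the following holds: if S is a (3,γ)-hyperelliptic numerical semigroup of genus g whose weight is maximal among all (3,γ)-hyperelliptic numerical semigroups of genus g, then 6 ∈ S. -/
/-- A numerical semigroup: a subset of ℕ containing 0, closed under addition,
with finite complement. -/
def IsNumericalSemigroup (S : Set ℕ) : Prop :=
  0 ∈ S ∧ (∀ a ∈ S, ∀ b ∈ S, a + b ∈ S) ∧ Sᶜ.Finite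

/-- The genus of a numerical semigroup: the number of gaps. -/
noncomputable def genus (S : Set ℕ) : ℕ := Sᶜ.ncard

/-- The weight of a numerical semigroup of genus g: writing the gaps as
ℓ_1 < ⋯ < ℓ_g, it is Σ (ℓ_i − i) = (Σ ℓ_i) − g(g+1)/2. -/
noncomputable def weight (S : Set ℕ) : ℤ :=
  (∑ᶠ ℓ ∈ Sᶜ, (ℓ : ℤ)) - (genus S * (genus S + 1)) / 2

/-- S is (N,γ)-hyperelliptic: the γ smallest positive elements of S are
n_1 < ⋯ < n_γ, all multiples of N with n_γ = 2γN, and (2γ+1)N ∈ S. -/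
def IsNgammaHyperelliptic (N γ : ℕ) (S : Set ℕ) : Prop :=
  IsNumericalSemigroup S ∧
  {s ∈ S | 0 < s ∧ s ≤ 2 * γ * N}.ncard = γ ∧
  (∀ s ∈ S, 0 < s → s ≤ 2 * γ * N → N ∣ s) ∧
  2 * γ * N ∈ S ∧
  (2 * γ + 1) * N ∈ S

/-- u₁(S): the smallest positive element of S not divisible by 3. -/
noncomputable def u1 (S : Set ℕ) : ℕ := sInf {s ∈ S | ¬ 3 ∣ s}

/-- χ(S) = u₁(S) − (g − 3γ + 1 + ⌊(g mod 3)/2⌋), computed in ℤ. -/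
noncomputable def chi (γ g : ℕ) (S : Set ℕ) : ℤ :=
  (u1 S : ℤ) - ((g : ℤ) - 3 * γ + 1 + ((g : ℤ) % 3) / 2)

/-- S_i: the elements of S ∩ {1,…,2g} congruent to i modulo 3. -/
def resSet (g i : ℕ) (S : Set ℕ) : Set ℕ :=
  {s ∈ S | 1 ≤ s ∧ s ≤ 2 * g ∧ s % 3 = i}

/-- The inflection Ĩ_S = Σ_{s ∈ S ∩ {1,…,2g}} s. -/
noncomputable def inflection (g : ℕ) (S : Set ℕ) : ℕ :=
  ∑ᶠ s ∈ {s ∈ S | 1 ≤ s ∧ s ≤ 2 * g}, s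

/-- The gap sets `H`, `A`, `B` of the three residue classes modulo 3 of a
`(3, γ)`-hyperelliptic semigroup, each divided by 3. -/
structure IsGapTriple (γ : ℕ) (H A B : Finset ℕ) : Prop where
  zero : 0 ∉ H
  lt : ∀ k ∈ H, k < 2 * γ
  card : H.card = γ
  addHH : ∀ a ∉ H, ∀ b ∉ H, a + b ∉ H
  addHA : ∀ a ∉ H, ∀ b ∉ A, a + b ∉ A
  addHB : ∀ a ∉ H, ∀ b ∉ B, a + b ∉ B
  addAA : ∀ a ∉ A, ∀ b ∉ A, a + b ∉ B
  addBB : ∀ a ∉ B, ∀ b ∉ B, a + b + 1 ∉ A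

/-- The gaps of the set whose residue classes modulo 3 have gap sets `H`, `A`, `B`. -/
def assembleGaps (H A B : Finset ℕ) : Finset ℕ :=
  H.image (fun k => 3 * k) ∪ A.image (fun k => 3 * k + 1) ∪ B.image (fun k => 3 * k + 2)

lemma mem_assembleGaps {H A B : Finset ℕ} {s : ℕ} :
    s ∈ assembleGaps H A B ↔
      (s % 3 = 0 ∧ s / 3 ∈ H) ∨ (s % 3 = 1 ∧ s / 3 ∈ A) ∨ (s % 3 = 2 ∧ s / 3 ∈ B) := by
  simp only [assembleGaps, Finset.mem_union, Finset.mem_image]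
  constructor
  · rintro ((⟨k, hk, rfl⟩ | ⟨k, hk, rfl⟩) | ⟨k, hk, rfl⟩)
    · left
      exact ⟨by omega, by rwa [show 3 * k / 3 = k by omega]⟩
    · right; left
      exact ⟨by omega, by rwa [show (3 * k + 1) / 3 = k by omega]⟩
    · right; right
      exact ⟨by omega, by rwa [show (3 * k + 2) / 3 = k by omega]⟩
  · rintro (⟨h, hk⟩ | ⟨h, hk⟩ | ⟨h, hk⟩)
    · exact Or.inl (Or.inl ⟨_, hk, by omega⟩)
    · exact Or.inl (Or.inr ⟨_, hk, by omega⟩)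
    · exact Or.inr ⟨_, hk, by omega⟩

lemma sum_assembleGaps (H A B : Finset ℕ) (f : ℕ → ℕ) :
    ∑ s ∈ assembleGaps H A B, f s =
      ∑ k ∈ H, f (3 * k) + ∑ k ∈ A, f (3 * k + 1) + ∑ k ∈ B, f (3 * k + 2) := by
  unfold assembleGaps
  rw [Finset.sum_union, Finset.sum_union, Finset.sum_image, Finset.sum_image, Finset.sum_image]
  · intro a _ b _ h
    simp only at h
    omega
  · intro a _ b _ h
    simp only at h
    omega
  · intro a _ b _ h
    simp only at h
    omega
  · rw [Finset.disjoint_left]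
    simp only [Finset.mem_image]
    rintro _ ⟨a, -, rfl⟩ ⟨b, -, h⟩
    omega
  · rw [Finset.disjoint_left]
    simp only [Finset.mem_image, Finset.mem_union]
    rintro _ (⟨a, -, rfl⟩ | ⟨a, -, rfl⟩) ⟨b, -, h⟩ <;> omega

lemma card_assembleGaps (H A B : Finset ℕ) :
    (assembleGaps H A B).card = H.card + A.card + B.card := by
  simpa using sum_assembleGaps H A B (fun _ => 1)

lemma sum_id_assembleGaps (H A B : Finset ℕ) :
    ∑ s ∈ assembleGaps H A B, s =
      3 * ∑ k ∈ H, k + (3 * ∑ k ∈ A, k + A.card) + (3 * ∑ k ∈ B, k + 2 * B.card) := by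
  rw [sum_assembleGaps H A B (fun s => s)]
  simp [Finset.sum_add_distrib, Finset.mul_sum, mul_comm]

lemma two_mul_sum_range_add (n : ℕ) : 2 * ∑ k ∈ Finset.range n, k + n = n * n := by
  induction n with
  | zero => simp
  | succ n ih => rw [Finset.sum_range_succ]; nlinarith

lemma two_mul_sum_card_filter_lt (s : Finset ℕ) :
    2 * ∑ x ∈ s, (s.filter (· < x)).card + s.card = s.card * s.card := by
  induction s using Finset.induction_on_max with
  | empty => simp
  | insert a s hs ih =>
    have ha : a ∉ s := fun h => lt_irrefl _ (hs a h)
    have h1 : (insert a s).filter (· < a) = s := by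
      ext y
      simp only [Finset.mem_filter, Finset.mem_insert]
      constructor
      · rintro ⟨rfl | h, h'⟩
        · exact absurd h' (lt_irrefl _)
        · exact h
      · exact fun h => ⟨Or.inr h, hs y h⟩
    have h2 : ∀ x ∈ s, ((insert a s).filter (· < x)).card = (s.filter (· < x)).card := by
      intro x hx
      rw [Finset.filter_insert, if_neg (by have := hs x hx; omega)]
    rw [Finset.sum_insert ha, h1, Finset.sum_congr rfl h2, Finset.card_insert_of_notMem ha]
    nlinarith

lemma exists_least_notMem (A : Finset ℕ) : ∃ a, a ∉ A ∧ Finset.range a ⊆ A := by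
  classical
  have h := Infinite.exists_notMem_finset A
  refine ⟨Nat.find h, Nat.find_spec h, fun k hk => ?_⟩
  exact not_not.mp (Nat.find_min h (Finset.mem_range.mp hk))

lemma card_le_of_shift {A B : Finset ℕ} {c : ℕ} (h : ∀ k ∉ A, c + k ∉ B) :
    B.card ≤ c + A.card := by
  have hsub : B ⊆ Finset.range c ∪ A.image (fun k => c + k) := by
    intro b hb
    simp only [Finset.mem_union, Finset.mem_range, Finset.mem_image]
    by_cases hbc : b < c
    · exact Or.inl hbc
    · refine Or.inr ⟨b - c, ?_, by omega⟩
      by_contra hA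
      apply h _ hA
      rwa [show c + (b - c) = b by omega]
  calc B.card ≤ _ := Finset.card_le_card hsub
    _ ≤ _ := Finset.card_union_le _ _
    _ ≤ c + A.card := by
      rw [Finset.card_range]
      exact Nat.add_le_add_left Finset.card_image_le _

lemma two_mul_sum_le {A : Finset ℕ} {a c : ℕ} (ha : Finset.range a ⊆ A)
    (hA : A ⊆ Finset.range (a + c)) :
    2 * ∑ k ∈ A, k + A.card ≤ A.card * A.card + c * c := by
  have h1 := Finset.card_le_card ha
  have h2 := Finset.card_le_card hA
  rw [Finset.card_range] at h1 h2
  have h3 := Finset.sum_sdiff (f := fun k : ℕ => k) hA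
  have h4 : (Finset.range (a + c) \ A).card * a ≤ ∑ k ∈ Finset.range (a + c) \ A, k := by
    rw [← smul_eq_mul]
    apply Finset.card_nsmul_le_sum
    intro k hk
    by_contra hka
    exact (Finset.mem_sdiff.mp hk).2 (ha (Finset.mem_range.mpr (by omega)))
  have h5 := two_mul_sum_range_add (a + c)
  rw [Finset.card_sdiff_of_subset hA, Finset.card_range] at h4
  generalize ∑ k ∈ Finset.range (a + c) \ A, k = D at h3 h4
  generalize ∑ k ∈ Finset.range (a + c), k = R at h3 h5
  obtain ⟨e, he⟩ := Nat.exists_eq_add_of_le h1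
  obtain ⟨d, hd⟩ := Nat.exists_eq_add_of_le h2
  rw [hd, Nat.add_sub_cancel_left] at h4
  rw [he] at *
  have hc : c = e + d := by omega
  subst hc
  nlinarith

lemma IsGapTriple.le_two_mul_card_filter {γ : ℕ} {H A B : Finset ℕ} (h : IsGapTriple γ H A B)
    {l : ℕ} (hl : l ∈ H) : l ≤ 2 * (H.filter (· < l)).card + 1 := by
  set F := H.filter (· < l) with hF
  have hsub : Finset.Icc 1 (l - 1) ⊆ F ∪ F.image (fun k => l - k) := by
    intro a ha
    rw [Finset.mem_Icc] at ha
    simp only [hF, Finset.mem_union, Finset.mem_image, Finset.mem_filter]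
    by_cases haH : a ∈ H
    · exact Or.inl ⟨haH, by omega⟩
    · refine Or.inr ⟨l - a, ⟨?_, by omega⟩, by omega⟩
      by_contra hla
      apply h.addHH _ haH _ hla
      rwa [show a + (l - a) = l by omega]
  have h1 := Finset.card_le_card hsub
  have h2 := Finset.card_union_le F (F.image (fun k => l - k))
  have h3 := Finset.card_image_le (s := F) (f := fun k => l - k)
  rw [Nat.card_Icc] at h1
  omega

/-- A semigroup of genus `γ` whose multiplicity is at least `m` has gap sum at most
`γ ^ 2 - (m - 2)`. -/
lemma IsGapTriple.sum_add_le {γ : ℕ} {H A B : Finset ℕ} (h : IsGapTriple γ H A B) {m : ℕ}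
    (hm : ∀ k, 0 < k → k < m → k ∈ H) : ∑ k ∈ H, k + m ≤ γ * γ + 2 := by
  have h1 : ∑ l ∈ H, (l + if 2 ≤ l ∧ l < m then 1 else 0) ≤
      ∑ l ∈ H, (2 * (H.filter (· < l)).card + 1) := by
    apply Finset.sum_le_sum
    intro l hl
    split_ifs with hlm
    · have hsub : Finset.Icc 1 (l - 1) ⊆ H.filter (· < l) := by
        intro k hk
        rw [Finset.mem_Icc] at hk
        exact Finset.mem_filter.mpr ⟨hm k (by omega) (by omega), by omega⟩
      have := Finset.card_le_card hsub
      rw [Nat.card_Icc] at this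
      omega
    · exact h.le_two_mul_card_filter hl
  have h2 : m ≤ ∑ l ∈ H, (if 2 ≤ l ∧ l < m then 1 else 0) + 2 := by
    rw [← Finset.card_filter]
    have hsub : Finset.Ico 2 m ⊆ H.filter (fun l => 2 ≤ l ∧ l < m) := by
      intro k hk
      rw [Finset.mem_Ico] at hk
      exact Finset.mem_filter.mpr ⟨hm k (by omega) hk.2, hk⟩
    have := Finset.card_le_card hsub
    rw [Nat.card_Ico] at this
    omega
  have h3 := two_mul_sum_card_filter_lt H
  rw [Finset.sum_add_distrib, Finset.sum_add_distrib, ← Finset.mul_sum, Finset.sum_const,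
    smul_eq_mul, mul_one] at h1
  rw [h.card] at *
  omega

lemma IsGapTriple.sum_lt {γ : ℕ} {H A B : Finset ℕ} (h : IsGapTriple γ H A B)
    (h1 : 1 ∈ H) (h2 : 2 ∈ H) : ∑ k ∈ H, k < γ * γ := by
  have := h.sum_add_le (m := 3) (by
    intro k hk hk3
    interval_cases k <;> assumption)
  omega

lemma IsGapTriple.card_B_le {γ : ℕ} {H A B : Finset ℕ} (h : IsGapTriple γ H A B) {a : ℕ}
    (ha : a ∉ A) : B.card ≤ a + A.card :=
  card_le_of_shift (fun k hk => h.addAA a ha k hk)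

lemma IsGapTriple.card_A_le {γ : ℕ} {H A B : Finset ℕ} (h : IsGapTriple γ H A B) {b : ℕ}
    (hb : b ∉ B) : A.card ≤ b + 1 + B.card :=
  card_le_of_shift (fun k hk => by
    have := h.addBB b hb k hk
    rwa [show b + k + 1 = b + 1 + k by omega] at this)

lemma subset_range_of_addH {γ : ℕ} {H A : Finset ℕ} (hH : ∀ k ∈ H, k < 2 * γ)
    (hA : ∀ a ∉ H, ∀ b ∉ A, a + b ∉ A) {a : ℕ} (ha : a ∉ A) :
    A ⊆ Finset.range (a + 2 * γ) := by
  intro k hk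
  rw [Finset.mem_range]
  by_contra hlt
  refine hA (k - a) (fun hmem => ?_) a ha ?_
  · have := hH _ hmem
    omega
  · rwa [show k - a + a = k by omega]

lemma IsGapTriple.gapSum_le {γ : ℕ} {H A B : Finset ℕ} (h : IsGapTriple γ H A B) :
    2 * ∑ s ∈ assembleGaps H A B, s + A.card ≤
      3 * (A.card * A.card + B.card * B.card) + B.card + 36 * (γ * γ) + 12 := by
  obtain ⟨a, ha, ha'⟩ := exists_least_notMem A
  obtain ⟨b, hb, hb'⟩ := exists_least_notMem B
  have hA := two_mul_sum_le ha' (subset_range_of_addH h.lt h.addHA ha)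
  have hB := two_mul_sum_le hb' (subset_range_of_addH h.lt h.addHB hb)
  have hH := h.sum_add_le (m := 0) (fun k _ hk => absurd hk (Nat.not_lt_zero k))
  rw [sum_id_assembleGaps]
  nlinarith

lemma IsGapTriple.card_bounds {γ : ℕ} {H A B : Finset ℕ} (h : IsGapTriple γ H A B) :
    B.card ≤ 2 * A.card ∧ A.card ≤ 2 * B.card + 1 := by
  obtain ⟨a, ha, ha'⟩ := exists_least_notMem A
  obtain ⟨b, hb, hb'⟩ := exists_least_notMem B
  have h1 := Finset.card_le_card ha'
  have h2 := Finset.card_le_card hb'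
  rw [Finset.card_range] at h1 h2
  have h3 := h.card_B_le ha
  have h4 := h.card_A_le hb
  omega

/-- If `#B = 2 * #A`, its largest possible value, both gap sets are initial segments. -/
lemma IsGapTriple.eq_range_of_card_B_eq {γ n : ℕ} {H A B : Finset ℕ} (h : IsGapTriple γ H A B)
    (hA : A.card = n) (hB : B.card = 2 * n) :
    A = Finset.range n ∧ B = Finset.range (2 * n) := by
  obtain ⟨a, ha, ha'⟩ := exists_least_notMem A
  have h1 := Finset.card_le_card ha'
  have h3 := h.card_B_le ha
  rw [Finset.card_range] at h1
  obtain rfl : a = n := by omega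
  have hAr : A = Finset.range a :=
    (Finset.eq_of_subset_of_card_le ha' (by rw [Finset.card_range, hA])).symm
  refine ⟨hAr, Finset.eq_of_subset_of_card_le (fun k hk => ?_) (by rw [Finset.card_range, hB])⟩
  rw [Finset.mem_range]
  by_contra hlt
  apply h.addAA a ha (k - a) (by rw [hAr, Finset.mem_range]; omega)
  rwa [show a + (k - a) = k by omega]

lemma IsGapTriple.eq_range_of_card_A_eq {γ n : ℕ} {H A B : Finset ℕ} (h : IsGapTriple γ H A B)
    (hA : A.card = 2 * n + 1) (hB : B.card = n) :
    A = Finset.range (2 * n + 1) ∧ B = Finset.range n := by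
  obtain ⟨b, hb, hb'⟩ := exists_least_notMem B
  have h1 := Finset.card_le_card hb'
  have h3 := h.card_A_le hb
  rw [Finset.card_range] at h1
  obtain rfl : b = n := by omega
  have hBr : B = Finset.range b :=
    (Finset.eq_of_subset_of_card_le hb' (by rw [Finset.card_range, hB])).symm
  refine ⟨Finset.eq_of_subset_of_card_le (fun k hk => ?_) (by rw [Finset.card_range, hA]), hBr⟩
  rw [Finset.mem_range]
  by_contra hlt
  apply h.addBB b hb (k - b - 1) (by rw [hBr, Finset.mem_range]; omega)
  rwa [show b + (k - b - 1) + 1 = k by omega]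

/-- For `#A = n + 1` and `#B = 2 * n + 1` the gap sum is less than that of the odd numbers below
`2 * γ` with `{0, …, n - 1, n + 1}` and `{0, …, 2 * n - 1, 2 * n + 1}`, when `1, 2 ∈ H`. -/
lemma IsGapTriple.sum_lt_of_card {γ n : ℕ} {H A B : Finset ℕ} (h : IsGapTriple γ H A B)
    (h1 : 1 ∈ H) (h2 : 2 ∈ H) (hA : A.card = n + 1) (hB : B.card = 2 * n + 1) :
    ∑ k ∈ H, k + ∑ k ∈ A, k + ∑ k ∈ B, k <
      γ * γ + (∑ k ∈ Finset.range n, k + (n + 1)) +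
        (∑ k ∈ Finset.range (2 * n), k + (2 * n + 1)) := by
  obtain ⟨a, ha, ha'⟩ := exists_least_notMem A
  have hac := Finset.card_le_card ha'
  have hBc := h.card_B_le ha
  rw [Finset.card_range] at hac
  obtain rfl | rfl : a = n + 1 ∨ a = n := by omega
  · have hAr : A = Finset.range (n + 1) :=
      (Finset.eq_of_subset_of_card_le ha' (by rw [Finset.card_range, hA])).symm
    have hBr : B ⊆ Finset.range (2 * n + 2) := by
      intro k hk
      rw [Finset.mem_range]
      by_contra hlt
      apply h.addAA (n + 1) ha (k - (n + 1)) (by rw [hAr, Finset.mem_range]; omega)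
      rwa [show n + 1 + (k - (n + 1)) = k by omega]
    have hcard : (Finset.range (2 * n + 2) \ B).card = 1 := by
      rw [Finset.card_sdiff_of_subset hBr, Finset.card_range, hB]
      omega
    obtain ⟨b, hb⟩ := Finset.card_eq_one.mp hcard
    have hbB : b ∉ B := by
      have : b ∈ Finset.range (2 * n + 2) \ B := by simp [hb]
      exact (Finset.mem_sdiff.mp this).2
    have hsum := Finset.sum_sdiff (f := fun k : ℕ => k) hBr
    rw [hb, Finset.sum_singleton, Finset.sum_range_succ, Finset.sum_range_succ] at hsum
    have hm := h.sum_add_le (m := 2 * n + 2 - b) (by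
      intro k hk hkb
      by_contra hkH
      have hkB := h.addHB k hkH b hbB
      have : k + b ∈ Finset.range (2 * n + 2) \ B :=
        Finset.mem_sdiff.mpr ⟨Finset.mem_range.mpr (by omega), hkB⟩
      rw [hb, Finset.mem_singleton] at this
      omega)
    rw [hAr, Finset.sum_range_succ]
    omega
  · have hcard : (A \ Finset.range a).card = 1 := by
      rw [Finset.card_sdiff_of_subset ha', Finset.card_range, hA]
      omega
    obtain ⟨c, hc⟩ := Finset.card_eq_one.mp hcard
    have hmem : ∀ k, a ≤ k → k ≠ c → k ∉ A := by
      intro k hk hkc hkA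
      have : k ∈ A \ Finset.range a :=
        Finset.mem_sdiff.mpr ⟨hkA, by rw [Finset.mem_range]; omega⟩
      rw [hc, Finset.mem_singleton] at this
      exact hkc this
    have hcA : c ∈ A ∧ a < c := by
      have : c ∈ A \ Finset.range a := by simp [hc]
      rw [Finset.mem_sdiff, Finset.mem_range] at this
      refine ⟨this.1, lt_of_le_of_ne (by omega) ?_⟩
      rintro rfl
      exact ha this.1
    have hca : c = a + 1 := by
      by_contra hne
      have hsub : B ⊆ Finset.range (2 * a) := by
        intro k hk
        rw [Finset.mem_range]
        by_contra hlt
        by_cases hkc : k - a = c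
        · apply h.addAA (a + 1) (hmem _ (by omega) (by omega)) (k - a - 1)
            (hmem _ (by omega) (by omega))
          rwa [show a + 1 + (k - a - 1) = k by omega]
        · apply h.addAA a ha (k - a) (hmem _ (by omega) hkc)
          rwa [show a + (k - a) = k by omega]
      have := Finset.card_le_card hsub
      rw [Finset.card_range] at this
      omega
    have hBr : B ⊆ insert (2 * a + 1) (Finset.range (2 * a)) := by
      intro k hk
      rw [Finset.mem_insert, Finset.mem_range]
      by_contra hlt
      apply h.addAA a ha (k - a) (hmem _ (by omega) (by omega))
      rwa [show a + (k - a) = k by omega]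
    have hBeq := Finset.eq_of_subset_of_card_le hBr (by
      rw [Finset.card_insert_of_notMem (by simp), Finset.card_range, hB])
    have hsum := Finset.sum_sdiff (f := fun k : ℕ => k) ha'
    rw [hc, Finset.sum_singleton] at hsum
    have hH := h.sum_lt h1 h2
    rw [hBeq, Finset.sum_insert (by simp)]
    omega

/-- The odd numbers below `2 * γ`, the gaps of the semigroup generated by `2` and `2 * γ + 1`. -/
def oddGaps (γ : ℕ) : Finset ℕ := (Finset.range γ).image (fun i => 2 * i + 1)

lemma mem_oddGaps {γ k : ℕ} : k ∈ oddGaps γ ↔ k % 2 = 1 ∧ k < 2 * γ := by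
  simp only [oddGaps, Finset.mem_image, Finset.mem_range]
  constructor
  · rintro ⟨i, hi, rfl⟩
    omega
  · rintro ⟨h1, h2⟩
    exact ⟨k / 2, by omega, by omega⟩

lemma card_oddGaps (γ : ℕ) : (oddGaps γ).card = γ := by
  rw [oddGaps, Finset.card_image_of_injective _ (fun a b h => by omega),
    Finset.card_range]

lemma sum_oddGaps (γ : ℕ) : ∑ k ∈ oddGaps γ, k = γ * γ := by
  rw [oddGaps, Finset.sum_image (fun a _ b _ h => by omega)]
  have := two_mul_sum_range_add γ
  rw [Finset.sum_add_distrib, ← Finset.mul_sum]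
  simpa using this

lemma isNumericalSemigroup_compl_assembleGaps {γ : ℕ} {A B : Finset ℕ}
    (hA : ∀ a ∉ oddGaps γ, ∀ b ∉ A, a + b ∉ A)
    (hB : ∀ a ∉ oddGaps γ, ∀ b ∉ B, a + b ∉ B)
    (hAA : ∀ a ∉ A, ∀ b ∉ A, a + b ∉ B)
    (hBB : ∀ a ∉ B, ∀ b ∉ B, a + b + 1 ∉ A)
    (hAB : ∀ a ∉ A, ∀ b ∉ B, 2 * γ ≤ a + b) :
    IsNumericalSemigroup {s | s ∉ assembleGaps (oddGaps γ) A B} := by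
  refine ⟨by simp [mem_assembleGaps, mem_oddGaps], ?_, ?_⟩
  · have hHH : ∀ a ∉ oddGaps γ, ∀ b ∉ oddGaps γ, a + b ∉ oddGaps γ := by
      intro a ha b hb
      rw [mem_oddGaps] at *
      omega
    have hABH : ∀ a ∉ A, ∀ b ∉ B, a + b + 1 ∉ oddGaps γ := by
      intro a ha b hb
      have := hAB a ha b hb
      rw [mem_oddGaps]
      omega
    intro a ha b hb
    simp only [Set.mem_ofPred_eq, mem_assembleGaps, not_or, not_and] at *
    have hq : ∀ i j, a % 3 = i → b % 3 = j → (a + b) / 3 = a / 3 + b / 3 + (i + j) / 3 := by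
      intro i j hi hj
      omega
    obtain hi | hi | hi : a % 3 = 0 ∨ a % 3 = 1 ∨ a % 3 = 2 := by omega
    all_goals
      obtain hj | hj | hj : b % 3 = 0 ∨ b % 3 = 1 ∨ b % 3 = 2 := by omega
    all_goals
      rw [hq _ _ hi hj]
      refine ⟨fun hs => ?_, fun hs => ?_, fun hs => ?_⟩ <;> first | omega | skip
    · exact hHH _ (ha.1 hi) _ (hb.1 hj)
    · exact hA _ (ha.1 hi) _ (hb.2.1 hj)
    · exact hB _ (ha.1 hi) _ (hb.2.2 hj)
    · rw [add_comm (a / 3)]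
      exact hA _ (hb.1 hj) _ (ha.2.1 hi)
    · exact hAA _ (ha.2.1 hi) _ (hb.2.1 hj)
    · exact hABH _ (ha.2.1 hi) _ (hb.2.2 hj)
    · rw [add_comm (a / 3)]
      exact hB _ (hb.1 hj) _ (ha.2.2 hi)
    · rw [add_comm (a / 3)]
      exact hABH _ (hb.2.1 hj) _ (ha.2.2 hi)
    · exact hBB _ (ha.2.2 hi) _ (hb.2.2 hj)
  · refine (assembleGaps (oddGaps γ) A B).finite_toSet.subset ?_
    intro s hs
    simpa using hs

lemma isNgammaHyperelliptic_compl_assembleGaps {γ : ℕ} {A B : Finset ℕ}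
    (hA : ∀ a ∉ oddGaps γ, ∀ b ∉ A, a + b ∉ A)
    (hB : ∀ a ∉ oddGaps γ, ∀ b ∉ B, a + b ∉ B)
    (hAA : ∀ a ∉ A, ∀ b ∉ A, a + b ∉ B)
    (hBB : ∀ a ∉ B, ∀ b ∉ B, a + b + 1 ∉ A)
    (hA' : ∀ a ∉ A, 2 * γ ≤ a) (hB' : ∀ b ∉ B, 2 * γ ≤ b) :
    IsNgammaHyperelliptic 3 γ {s | s ∉ assembleGaps (oddGaps γ) A B} := by
  have hdvd : ∀ s ∉ assembleGaps (oddGaps γ) A B, s ≤ 2 * γ * 3 → s % 3 = 0 := by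
    intro s hs hle
    simp only [mem_assembleGaps, not_or, not_and] at hs
    by_contra h0
    obtain h | h : s % 3 = 1 ∨ s % 3 = 2 := by omega
    · have := hA' _ (hs.2.1 h)
      omega
    · have := hB' _ (hs.2.2 h)
      omega
  refine ⟨isNumericalSemigroup_compl_assembleGaps hA hB hAA hBB
    (fun a ha b _ => (hA' a ha).trans (Nat.le_add_right a b)), ?_, ?_, ?_, ?_⟩
  · have : {s ∈ {s | s ∉ assembleGaps (oddGaps γ) A B} | 0 < s ∧ s ≤ 2 * γ * 3} =
        ↑((Finset.range γ).image (fun i => 6 * (i + 1))) := by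
      ext s
      simp only [Set.mem_ofPred_eq, Finset.coe_image, Set.mem_image, Finset.mem_coe,
        Finset.mem_range]
      constructor
      · rintro ⟨hs, hpos, hle⟩
        have h3 := hdvd s hs hle
        simp only [mem_assembleGaps, mem_oddGaps, not_or, not_and] at hs
        have := hs.1 h3
        exact ⟨s / 6 - 1, by omega, by omega⟩
      · rintro ⟨i, hi, rfl⟩
        refine ⟨?_, by omega, by omega⟩
        simp only [mem_assembleGaps, mem_oddGaps]
        omega
    rw [this, Set.ncard_coe_finset,
      Finset.card_image_of_injective _ (fun a b h => by omega), Finset.card_range]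
  · intro s hs _ hle
    exact Nat.dvd_of_mod_eq_zero (hdvd s hs hle)
  · simp only [Set.mem_ofPred_eq, mem_assembleGaps, mem_oddGaps]
    omega
  · simp only [Set.mem_ofPred_eq, mem_assembleGaps, mem_oddGaps]
    omega

lemma genus_of_compl_eq {S : Set ℕ} {E : Finset ℕ} (h : Sᶜ = ↑E) : genus S = E.card := by
  rw [genus, h, Set.ncard_coe_finset]

lemma weight_of_compl_eq {S : Set ℕ} {E : Finset ℕ} (h : Sᶜ = ↑E) :
    weight S = ((∑ s ∈ E, s : ℕ) : ℤ) - (genus S * (genus S + 1)) / 2 := by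
  rw [weight, h, finsum_mem_coe_finset, Nat.cast_sum]

/-- For a large parameter, a triple with `1, 2 ∈ H` does not attain the maximal gap sum. -/
lemma IsGapTriple.exists_gapSum_lt {γ : ℕ} {H A B : Finset ℕ} (h : IsGapTriple γ H A B)
    (h1 : 1 ∈ H) (h2 : 2 ∈ H) (hN : 60 * (γ * γ) + 6 * γ + 60 ≤ A.card + B.card) :
    ∃ T, IsNgammaHyperelliptic 3 γ T ∧ ∃ E : Finset ℕ, Tᶜ = ↑E ∧
      E.card = γ + A.card + B.card ∧
      ∑ s ∈ assembleGaps H A B, s < ∑ s ∈ E, s := by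
  suffices hAB : ∃ A' B' : Finset ℕ, A'.card + B'.card = A.card + B.card ∧
      (∀ a ∉ oddGaps γ, ∀ b ∉ A', a + b ∉ A') ∧ (∀ a ∉ oddGaps γ, ∀ b ∉ B', a + b ∉ B') ∧
      (∀ a ∉ A', ∀ b ∉ A', a + b ∉ B') ∧ (∀ a ∉ B', ∀ b ∉ B', a + b + 1 ∉ A') ∧
      (∀ a ∉ A', 2 * γ ≤ a) ∧ (∀ b ∉ B', 2 * γ ≤ b) ∧
      ∑ s ∈ assembleGaps H A B, s < ∑ s ∈ assembleGaps (oddGaps γ) A' B', s by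
    obtain ⟨A', B', hcard, hA, hB, hAA, hBB, hA', hB', hlt⟩ := hAB
    refine ⟨_, isNgammaHyperelliptic_compl_assembleGaps hA hB hAA hBB hA' hB',
      assembleGaps (oddGaps γ) A' B', ?_, ?_, hlt⟩
    · ext s
      simp
    · rw [card_assembleGaps, card_oddGaps]
      omega
  have hle := h.gapSum_le
  obtain ⟨hb1, hb2⟩ := h.card_bounds
  have hHlt := h.sum_lt h1 h2
  obtain ⟨n, hn⟩ : ∃ n, A.card + B.card = 3 * n ∨ A.card + B.card = 3 * n + 1 ∨
      A.card + B.card = 3 * n + 2 := ⟨(A.card + B.card) / 3, by omega⟩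
  have hγ := h.lt 1 h1
  have hnγ : 20 * (γ * γ) + 19 ≤ n := by omega
  have hn2 : 2 * γ ≤ n := by omega
  obtain hn | hn | hn := hn
  · refine ⟨Finset.range n, Finset.range (2 * n), by simp only [Finset.card_range]; omega,
      ?_, ?_, ?_, ?_, ?_, ?_, ?_⟩
    iterate 6
      intros
      simp only [Finset.mem_range] at *
      omega
    by_cases hx : A.card = n
    · obtain ⟨hA, hB⟩ := h.eq_range_of_card_B_eq hx (by omega)
      rw [sum_id_assembleGaps, sum_id_assembleGaps, sum_oddGaps, hA, hB]
      omega
    · rw [sum_id_assembleGaps _ (Finset.range n), sum_oddGaps]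
      have e1 := two_mul_sum_range_add n
      have e2 := two_mul_sum_range_add (2 * n)
      simp only [Finset.card_range]
      obtain ⟨d, hd⟩ : ∃ d, A.card = n + 1 + d := ⟨A.card - n - 1, by omega⟩
      obtain ⟨e, he⟩ : ∃ e, B.card = n + e := ⟨B.card - n, by omega⟩
      have hne : n = d + e + 1 := by omega
      rw [hd, he] at hle
      have hde : 0 ≤ d * e := Nat.zero_le _
      subst hne
      nlinarith
  · refine ⟨Finset.range (2 * n + 1), Finset.range n, by simp only [Finset.card_range]; omega,
      ?_, ?_, ?_, ?_, ?_, ?_, ?_⟩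
    iterate 6
      intros
      simp only [Finset.mem_range] at *
      omega
    by_cases hx : B.card = n
    · obtain ⟨hA, hB⟩ := h.eq_range_of_card_A_eq (by omega) hx
      rw [sum_id_assembleGaps, sum_id_assembleGaps, sum_oddGaps, hA, hB]
      omega
    · rw [sum_id_assembleGaps _ (Finset.range (2 * n + 1)), sum_oddGaps]
      have e1 := two_mul_sum_range_add n
      have e2 := two_mul_sum_range_add (2 * n + 1)
      simp only [Finset.card_range]
      obtain ⟨d, hd⟩ : ∃ d, B.card = n + 1 + d := ⟨B.card - n - 1, by omega⟩
      obtain ⟨e, he⟩ : ∃ e, A.card = n + 1 + e := ⟨A.card - n - 1, by omega⟩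
      have hne : n = d + e + 1 := by omega
      rw [hd, he] at hle
      have hde : 0 ≤ d * e := Nat.zero_le _
      subst hne
      nlinarith
  · have hc1 : (insert (n + 1) (Finset.range n)).card = n + 1 := by
      rw [Finset.card_insert_of_notMem (by simp), Finset.card_range]
    have hc2 : (insert (2 * n + 1) (Finset.range (2 * n))).card = 2 * n + 1 := by
      rw [Finset.card_insert_of_notMem (by simp), Finset.card_range]
    refine ⟨insert (n + 1) (Finset.range n), insert (2 * n + 1) (Finset.range (2 * n)), by omega,
      ?_, ?_, ?_, ?_, ?_, ?_, ?_⟩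
    · intro a ha b hb
      simp only [Finset.mem_range, Finset.mem_insert, mem_oddGaps] at *
      omega
    · intro a ha b hb
      simp only [Finset.mem_range, Finset.mem_insert, mem_oddGaps] at *
      omega
    iterate 4
      intros
      simp only [Finset.mem_range, Finset.mem_insert] at *
      omega
    rw [sum_id_assembleGaps _ (insert _ _), sum_oddGaps, hc1, hc2,
      Finset.sum_insert (by simp), Finset.sum_insert (by simp)]
    by_cases hx : A.card = n + 1
    · have hlt := h.sum_lt_of_card h1 h2 hx (by omega)
      rw [sum_id_assembleGaps]
      omega
    · have e1 := two_mul_sum_range_add n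
      have e2 := two_mul_sum_range_add (2 * n)
      obtain ⟨d, hd⟩ : ∃ d, A.card = n + 2 + d := ⟨A.card - n - 2, by omega⟩
      obtain ⟨e, he⟩ : ∃ e, B.card = n + 1 + e := ⟨B.card - n - 1, by omega⟩
      have hne : n = d + e + 1 := by omega
      rw [hd, he] at hle
      have hde : 0 ≤ d * e := Nat.zero_le _
      subst hne
      nlinarith

/-- If `γ` of the numbers `1, …, 2γ` lie in `H`, as do `2γ` and `2γ + 1`, then `H` contains
every number from `2γ` on. -/
lemma mem_of_two_mul_le {H : Set ℕ} {γ : ℕ} {P : Finset ℕ}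
    (hadd : ∀ a ∈ H, ∀ b ∈ H, a + b ∈ H)
    (hP : ∀ k, k ∈ P ↔ k ∈ H ∧ 0 < k ∧ k ≤ 2 * γ) (hcard : P.card = γ)
    (h0 : 2 * γ ∈ H) (h1 : 2 * γ + 1 ∈ H) (k : ℕ) (hk : 2 * γ ≤ k) : k ∈ H := by
  induction k using Nat.strong_induction_on with
  | _ k ih =>
    by_contra hkH
    have hk2 : 2 * γ + 2 ≤ k := by
      by_contra hlt
      obtain rfl | rfl : k = 2 * γ ∨ k = 2 * γ + 1 := by omega
      · exact hkH h0
      · exact hkH h1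
    have hPsub : P ⊆ Finset.Icc 1 (2 * γ) := fun a ha =>
      Finset.mem_Icc.mpr ((hP a).mp ha).2
    have hnot : 2 * γ + 1 ∉ P := fun hmem => by
      have := ((hP _).mp hmem).2.2
      omega
    have hins : ∀ a ∈ insert (2 * γ + 1) P, a ∈ H ∧ 0 < a ∧ a ≤ 2 * γ + 1 := by
      intro a ha
      rcases Finset.mem_insert.mp ha with rfl | ha
      · exact ⟨h1, by omega, le_rfl⟩
      · obtain ⟨h, h', h''⟩ := (hP a).mp ha
        exact ⟨h, h', by omega⟩
    have hmaps : ∀ a ∈ insert (2 * γ + 1) P, k - a ∈ Finset.Icc 1 (2 * γ) \ P := by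
      intro a ha
      obtain ⟨haH, hpos, hle⟩ := hins a ha
      have hka : k - a ∉ H := by
        intro hmem
        apply hkH
        have := hadd _ haH _ hmem
        rwa [show a + (k - a) = k by omega] at this
      have hlt : k - a < 2 * γ := by
        by_contra hge
        exact hka (ih (k - a) (by omega) (by omega))
      exact Finset.mem_sdiff.mpr ⟨Finset.mem_Icc.mpr ⟨by omega, by omega⟩,
        fun hmem => hka ((hP _).mp hmem).1⟩
    have hinj : Set.InjOn (fun a => k - a) (insert (2 * γ + 1) P : Finset ℕ) := by
      intro a ha b hb hab
      have h1 := (hins a ha).2.2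
      have h2 := (hins b hb).2.2
      simp only at hab
      omega
    have hle := Finset.card_le_card_of_injOn _ hmaps hinj
    rw [Finset.card_insert_of_notMem hnot, Finset.card_sdiff_of_subset hPsub, Nat.card_Icc,
      hcard] at hle
    omega

lemma finite_slice_compl {S : Set ℕ} (hS : Sᶜ.Finite) (i : ℕ) : {k | 3 * k + i ∉ S}.Finite :=
  hS.preimage (f := fun k => 3 * k + i) (fun a _ b _ h => by simp only at h; omega)

lemma IsNgammaHyperelliptic.exists_isGapTriple {γ : ℕ} {S : Set ℕ}
    (hS : IsNgammaHyperelliptic 3 γ S) :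
    ∃ H A B : Finset ℕ, IsGapTriple γ H A B ∧ Sᶜ = ↑(assembleGaps H A B) ∧
      ∀ k, k ∈ H ↔ 3 * k ∉ S := by
  obtain ⟨⟨hzero, hadd, hfin⟩, hcard, hdvd, h2, h3⟩ := hS
  obtain ⟨H, hH⟩ := (finite_slice_compl hfin 0).exists_finset
  obtain ⟨A, hA⟩ := (finite_slice_compl hfin 1).exists_finset
  obtain ⟨B, hB⟩ := (finite_slice_compl hfin 2).exists_finset
  simp only [Set.mem_ofPred_eq, add_zero] at hH hA hB
  set P := (Finset.Icc 1 (2 * γ)) \ H with hPdef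
  have hP : ∀ k, k ∈ P ↔ k ∈ {k | 3 * k ∈ S} ∧ 0 < k ∧ k ≤ 2 * γ := by
    intro k
    simp only [hPdef, Finset.mem_sdiff, Finset.mem_Icc, hH, not_not, Set.mem_ofPred_eq]
    tauto
  have hPcard : P.card = γ := by
    have himg : {s ∈ S | 0 < s ∧ s ≤ 2 * γ * 3} = ↑(P.image (fun k => 3 * k)) := by
      ext s
      simp only [Set.mem_ofPred_eq, Finset.coe_image, Set.mem_image, Finset.mem_coe, hP]
      constructor
      · rintro ⟨hs, hpos, hle⟩
        obtain ⟨k, rfl⟩ := hdvd s hs hpos hle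
        exact ⟨k, ⟨hs, by omega, by omega⟩, rfl⟩
      · rintro ⟨k, ⟨hk, hpos, hle⟩, rfl⟩
        exact ⟨hk, by omega, by omega⟩
    rw [himg, Set.ncard_coe_finset,
      Finset.card_image_of_injective _ (fun a b h => by omega)] at hcard
    exact hcard
  have hlarge := mem_of_two_mul_le (H := {k | 3 * k ∈ S}) (P := P)
    (fun a ha b hb => by
      have := hadd _ ha _ hb
      rwa [← mul_add] at this)
    hP hPcard (by rwa [Set.mem_ofPred_eq, mul_comm]) (by rwa [Set.mem_ofPred_eq, mul_comm])
  have hlt : ∀ k ∈ H, k < 2 * γ := by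
    intro k hk
    by_contra hge
    exact (hH k).mp hk (hlarge k (by omega))
  have h0 : 0 ∉ H := by simpa [hH] using hzero
  refine ⟨H, A, B, ⟨h0, hlt, ?_, ?_, ?_, ?_, ?_, ?_⟩, ?_, hH⟩
  · have hsub : H ⊆ Finset.Icc 1 (2 * γ) := by
      intro k hk
      have hk0 : k ≠ 0 := fun h => h0 (h ▸ hk)
      exact Finset.mem_Icc.mpr ⟨by omega, (hlt k hk).le⟩
    have := Finset.card_sdiff_add_card_eq_card hsub
    rw [← hPdef, hPcard, Nat.card_Icc] at this
    omega
  all_goals try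
    intro a ha b hb
    simp only [hH, hA, hB, not_not] at *
    have := hadd _ ha _ hb
    ring_nf at this ⊢
    exact this
  ext s
  simp only [Set.mem_compl_iff, Finset.mem_coe, mem_assembleGaps, hH, hA, hB]
  obtain hs | hs | hs : s % 3 = 0 ∨ s % 3 = 1 ∨ s % 3 = 2 := by omega
  · simp [hs, show 3 * (s / 3) = s by omega]
  · simp [hs, show 3 * (s / 3) + 1 = s by omega]
  · simp [hs, show 3 * (s / 3) + 2 = s by omega]

/-- for g ≫ γ, a maximal-weight (3,γ)-hyperelliptic semigroup
of genus g contains 6. -/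
theorem stmt12 (γ : ℕ) (hγ : 1 ≤ γ) :
    ∃ g₀ : ℕ, ∀ g ≥ g₀, ∀ S : Set ℕ,
      IsNgammaHyperelliptic 3 γ S → genus S = g →
      (∀ T : Set ℕ, IsNgammaHyperelliptic 3 γ T → genus T = g →
        weight T ≤ weight S) →
      6 ∈ S := by
  refine ⟨60 * (γ * γ) + 7 * γ + 60, fun g hg S hS hgenus hmax => ?_⟩
  by_contra h6
  obtain ⟨H, A, B, h, hcompl, hH⟩ := hS.exists_isGapTriple
  have hcard := genus_of_compl_eq hcompl
  rw [card_assembleGaps, h.card, hgenus] at hcard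
  have h2 : 2 ∈ H := (hH 2).mpr h6
  have h1 : 1 ∈ H := by
    by_contra h1
    exact h.addHH 1 h1 1 h1 h2
  obtain ⟨T, hT, E, hE, hEcard, hlt⟩ := h.exists_gapSum_lt h1 h2 (by omega)
  have hTg : genus T = g := by rw [genus_of_compl_eq hE, hEcard, hcard]
  have hle := hmax T hT hTg
  rw [weight_of_compl_eq hE, weight_of_compl_eq hcompl, hTg, hgenus] at hle
  omega
end

section
/- For every γ ≥ 0 there exists g₀ such that for all g ≥ g₀ with (g − γ) mod 3 ≠ 2 the following holds: the maximum of W_S over all (3,γ)-hyperelliptic numerical semigroups S of genus g is attained, and setting B = g − γ, this maximum W satisfies 6·W = B(5B+1) + 18γ² − 3g(g+1). -/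
/-- Splitting a finite sum over ℕ along residue classes modulo 3. -/
lemma sum_eq_sum_residues {M : Type*} [AddCommMonoid M] {C G₀ G₁ G₂ : Finset ℕ}
    (h₀ : ∀ n, n ∈ G₀ ↔ 3 * n ∈ C) (h₁ : ∀ n, n ∈ G₁ ↔ 3 * n + 1 ∈ C)
    (h₂ : ∀ n, n ∈ G₂ ↔ 3 * n + 2 ∈ C) (f : ℕ → M) :
    ∑ n ∈ C, f n =
      ∑ n ∈ G₀, f (3 * n) + ∑ n ∈ G₁, f (3 * n + 1) + ∑ n ∈ G₂, f (3 * n + 2) := by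
  have key : ∀ (i : ℕ) (G : Finset ℕ), i < 3 → (∀ n, n ∈ G ↔ 3 * n + i ∈ C) →
      ∑ n ∈ C with n % 3 = i, f n = ∑ n ∈ G, f (3 * n + i) := by
    intro i G hi hG
    refine Finset.sum_nbij' (fun n => n / 3) (fun n => 3 * n + i) ?_ ?_ ?_ ?_ ?_
    · intro n hn
      obtain ⟨hn, hni⟩ := Finset.mem_filter.1 hn
      rw [hG]
      convert hn using 1
      omega
    · intro n hn
      exact Finset.mem_filter.2 ⟨(hG n).1 hn, by omega⟩
    · intro n hn
      have := (Finset.mem_filter.1 hn).2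
      omega
    · intro n hn
      omega
    · intro n hn
      have := (Finset.mem_filter.1 hn).2
      congr 1
      omega
  rw [← Finset.sum_fiberwise_of_maps_to (s := C) (t := Finset.range 3) (g := fun n => n % 3)
    (fun n _ => Finset.mem_range.2 (Nat.mod_lt n (by norm_num)))]
  simp only [Finset.sum_range_succ, Finset.sum_range_zero, zero_add]
  rw [key 0 G₀ (by norm_num) h₀, key 1 G₁ (by norm_num) h₁, key 2 G₂ (by norm_num) h₂]
  rfl

lemma two_mul_weight {S : Set ℕ} {C : Finset ℕ} (hC : ∀ n, n ∈ C ↔ n ∉ S) :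
    2 * weight S = 2 * ∑ n ∈ C, (n : ℤ) - genus S * (genus S + 1) := by
  have hS : Sᶜ = (C : Set ℕ) := by ext n; simp [hC]
  have h : (2 : ℤ) ∣ genus S * (genus S + 1) := (Int.even_mul_succ_self _).two_dvd
  rw [weight, hS, finsum_mem_coe_finset]
  omega

lemma genus_eq_card {S : Set ℕ} {C : Finset ℕ} (hC : ∀ n, n ∈ C ↔ n ∉ S) :
    genus S = C.card := by
  have hS : Sᶜ = (C : Set ℕ) := by ext n; simp [hC]
  rw [genus, hS, Set.ncard_coe_finset]

/-- The genus and the weight in terms of the gaps `3n`, `3n + 1`, `3n + 2`. -/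
lemma genus_and_weight_of_residues {S : Set ℕ} {G₀ G₁ G₂ : Finset ℕ} (hS : Sᶜ.Finite)
    (h₀ : ∀ n, n ∈ G₀ ↔ 3 * n ∉ S) (h₁ : ∀ n, n ∈ G₁ ↔ 3 * n + 1 ∉ S)
    (h₂ : ∀ n, n ∈ G₂ ↔ 3 * n + 2 ∉ S) :
    genus S = G₀.card + G₁.card + G₂.card ∧
    2 * weight S = 6 * ∑ n ∈ G₀, (n : ℤ) + (6 * ∑ n ∈ G₁, (n : ℤ) + 2 * G₁.card) +
      (6 * ∑ n ∈ G₂, (n : ℤ) + 4 * G₂.card) - genus S * (genus S + 1) := by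
  have hC : ∀ n, n ∈ hS.toFinset ↔ n ∉ S := by simp
  have split : ∀ f : ℕ → ℤ, _ := sum_eq_sum_residues (C := hS.toFinset)
    (G₀ := G₀) (G₁ := G₁) (G₂ := G₂)
    (fun n => by rw [hC, h₀]) (fun n => by rw [hC, h₁]) (fun n => by rw [hC, h₂])
  constructor
  · have := split fun _ => 1
    simp only [Finset.sum_const, nsmul_eq_mul, mul_one] at this
    rw [genus_eq_card hC]
    exact_mod_cast this
  · rw [two_mul_weight hC, split]
    push_cast
    simp only [Finset.sum_add_distrib, ← Finset.mul_sum, Finset.sum_const, nsmul_eq_mul]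
    ring

/-- If `n` is a gap, then for each `x ≤ n` one of `x`, `n - x` is a gap. -/
lemma succ_le_two_mul_card_gaps_le {G : Finset ℕ}
    (hadd : ∀ a b, a ∉ G → b ∉ G → a + b ∉ G) {n : ℕ} (hn : n ∈ G) :
    n + 1 ≤ 2 * (G.filter (· ≤ n)).card := by
  have hsub : Finset.range (n + 1) ⊆
      G.filter (· ≤ n) ∪ (G.filter (· ≤ n)).image (n - ·) := by
    intro x hx
    have hx : x ≤ n := Nat.lt_succ_iff.1 (Finset.mem_range.1 hx)
    simp only [Finset.mem_union, Finset.mem_filter, Finset.mem_image]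
    by_cases hxG : x ∈ G
    · exact Or.inl ⟨hxG, hx⟩
    · refine Or.inr ⟨n - x, ⟨?_, Nat.sub_le _ _⟩, by omega⟩
      by_contra h
      exact hadd _ _ hxG h (by rwa [Nat.add_sub_cancel' hx])
  have h₁ := (Finset.card_le_card hsub).trans (Finset.card_union_le _ _)
  have h₂ := Finset.card_image_le (s := G.filter (· ≤ n)) (f := (n - ·))
  rw [Finset.card_range] at h₁
  omega

lemma two_mul_sum_card_filter_le (G : Finset ℕ) :
    2 * ∑ n ∈ G, (G.filter (· ≤ n)).card = G.card * (G.card + 1) := by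
  have hswap : ∑ n ∈ G, (G.filter (· ≤ n)).card = ∑ n ∈ G, (G.filter (n ≤ ·)).card := by
    simp only [Finset.card_filter]
    exact Finset.sum_comm
  have hadd : ∀ n ∈ G, (G.filter (· ≤ n)).card + (G.filter (n ≤ ·)).card = G.card + 1 := by
    intro n hn
    rw [← Finset.card_union_add_card_inter]
    congr 1
    · congr 1
      ext m
      simp only [Finset.mem_union, Finset.mem_filter]
      have := le_total m n
      tauto
    · rw [Finset.card_eq_one]
      refine ⟨n, ?_⟩
      ext m
      simp only [Finset.mem_inter, Finset.mem_filter, Finset.mem_singleton]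
      constructor
      · rintro ⟨⟨_, h⟩, _, h'⟩
        exact le_antisymm h h'
      · rintro rfl
        exact ⟨⟨hn, le_rfl⟩, hn, le_rfl⟩
  rw [two_mul]
  nth_rw 2 [hswap]
  rw [← Finset.sum_add_distrib, Finset.sum_congr rfl hadd, Finset.sum_const, smul_eq_mul]

/-- The gaps of a numerical semigroup of genus `γ` have sum at most `γ²`. -/
lemma sum_gaps_le_card_sq {G : Finset ℕ} (hadd : ∀ a b, a ∉ G → b ∉ G → a + b ∉ G) :
    ∑ n ∈ G, n ≤ G.card ^ 2 := by
  have h := Finset.sum_le_sum fun n (hn : n ∈ G) => succ_le_two_mul_card_gaps_le hadd hn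
  rw [Finset.sum_add_distrib, ← Finset.mul_sum, two_mul_sum_card_filter_le] at h
  simp only [Finset.sum_const, smul_eq_mul, mul_one] at h
  nlinarith

/-- If exactly `γ` gaps are at most `2γ` and `2γ + 1` is not a gap, all gaps are below `2γ + 1`. -/
lemma gaps_le_two_mul {G : Finset ℕ} {γ : ℕ} (hadd : ∀ a b, a ∉ G → b ∉ G → a + b ∉ G)
    (hcard : (G.filter (· ≤ 2 * γ)).card = γ) (hγ : 2 * γ + 1 ∉ G) :
    ∀ n ∈ G, n ≤ 2 * γ := by
  intro n
  induction n using Nat.strong_induction_on with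
  | _ n ih =>
    intro hn
    by_contra! hlt
    have hsub : G.filter (· ≤ n) ⊆ insert n (G.filter (· ≤ 2 * γ)) := by
      intro m hm
      obtain ⟨hmG, hmn⟩ := Finset.mem_filter.1 hm
      rcases hmn.lt_or_eq with h | h
      · exact Finset.mem_insert_of_mem (Finset.mem_filter.2 ⟨hmG, ih m h hmG⟩)
      · exact h ▸ Finset.mem_insert_self _ _
    have h₁ := (Finset.card_le_card hsub).trans (Finset.card_insert_le _ _)
    have h₂ := succ_le_two_mul_card_gaps_le hadd hn
    have h₃ : n = 2 * γ + 1 := by omega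
    exact hγ (h₃ ▸ hn)

lemma two_mul_sum_range (n : ℕ) : 2 * ∑ i ∈ Finset.range n, (i : ℤ) = n * (n - 1) := by
  induction n with
  | zero => simp
  | succ n ih =>
    rw [Finset.sum_range_succ, mul_add, ih]
    push_cast
    ring

/-- A finite set squeezed between two initial segments has almost minimal sum. -/
lemma two_mul_sum_le_of_range_subset {G : Finset ℕ} {p m : ℕ} (hp : Finset.range p ⊆ G)
    (hm : G ⊆ Finset.range (p + m)) :
    2 * ∑ n ∈ G, (n : ℤ) ≤ G.card * (G.card - 1) + 2 * m ^ 2 := by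
  have hsum := Finset.sum_sdiff (s₁ := Finset.range p) (s₂ := G) (f := fun n : ℕ => (n : ℤ)) hp
  have hcard := Finset.card_sdiff_add_card_eq_card hp
  have hgauss := two_mul_sum_range p
  have hle : ∑ n ∈ G \ Finset.range p, (n : ℤ) ≤
      (G \ Finset.range p).card • ((p : ℤ) + m) := by
    refine Finset.sum_le_card_nsmul _ _ _ fun n hn => ?_
    have := Finset.mem_range.1 (hm (Finset.mem_sdiff.1 hn).1)
    exact_mod_cast this.le
  have hexc : (G \ Finset.range p).card ≤ m := by
    have := Finset.card_le_card hm
    simp only [Finset.card_range] at hcard this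
    omega
  rw [Finset.card_range] at hcard
  rw [nsmul_eq_mul] at hle
  have hcard' : (G.card : ℤ) = (G \ Finset.range p).card + p := by exact_mod_cast hcard.symm
  have hexc' : ((G \ Finset.range p).card : ℤ) ≤ m := by exact_mod_cast hexc
  rw [hcard']
  set e : ℤ := ((G \ Finset.range p).card : ℤ)
  have he : 0 ≤ e := Int.natCast_nonneg _
  have he2 : e ≤ e ^ 2 := by
    have : e * (e - 1) = e ^ 2 - e := by ring
    have : 0 ≤ e * (e - 1) := by
      rcases he.eq_or_lt with h | h
      · simp [← h]
      · exact mul_nonneg he (by omega)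
    linarith
  nlinarith [mul_le_mul_of_nonneg_right hexc' (Int.natCast_nonneg m)]

/-- If the complements satisfy `A + A + c ⊆ A'` and `A` starts at `p`, then `A'` has at most
`p + c` more gaps than `A`. -/
lemma card_gaps_le_add {G G' : Finset ℕ} {p c : ℕ} (hp : p ∉ G)
    (hadd : ∀ a b, a ∉ G → b ∉ G → a + b + c ∉ G') : G'.card ≤ G.card + (p + c) := by
  have hsub : G' ⊆ G.image (· + (p + c)) ∪ Finset.range (p + c) := by
    intro n hn
    simp only [Finset.mem_union, Finset.mem_image, Finset.mem_range]
    by_contra! h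
    refine hadd (n - (p + c)) p (fun hG => h.1 _ hG (by omega)) hp ?_
    convert hn using 1
    omega
  have h₁ := (Finset.card_le_card hsub).trans (Finset.card_union_le _ _)
  have h₂ := Finset.card_image_le (s := G) (f := (· + (p + c)))
  rw [Finset.card_range] at h₁
  omega

lemma exists_initial_segment {G D : Finset ℕ} {m : ℕ} (hD : ∀ n ∈ D, n < m)
    (hadd : ∀ a d, a ∉ G → d ∉ D → a + d ∉ G) :
    ∃ p ∉ G, Finset.range p ⊆ G ∧ G ⊆ Finset.range (p + m) := by
  classical
  have hex : ∃ p, p ∉ G := Infinite.exists_notMem_finset G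
  refine ⟨Nat.find hex, Nat.find_spec hex, fun n hn => ?_, fun n hn => ?_⟩
  · exact not_not.1 (Nat.find_min hex (Finset.mem_range.1 hn))
  · rw [Finset.mem_range]
    by_contra! h
    refine hadd _ (n - Nat.find hex) (Nat.find_spec hex) (fun hd => ?_) ?_
    · have := hD _ hd
      omega
    · rwa [Nat.add_sub_cancel' (by omega)]

/-- Extremal case: with `A + A + c ⊆ A'`, if `A'` has the largest possible number of gaps then
both complements are final segments. -/
lemma eq_range_of_card_eq {G G' : Finset ℕ} {p c : ℕ} (hp : p ∉ G) (hpG : Finset.range p ⊆ G)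
    (hadd : ∀ a b, a ∉ G → b ∉ G → a + b + c ∉ G') (hcard : G'.card = 2 * G.card + c) :
    G = Finset.range G.card ∧ G' = Finset.range G'.card := by
  have h₁ := card_gaps_le_add hp hadd
  have h₂ := Finset.card_le_card hpG
  rw [Finset.card_range] at h₂
  have hG : Finset.range p = G := Finset.eq_of_subset_of_card_le hpG (by simp; omega)
  have hc : G.card = p := by rw [← hG, Finset.card_range]
  refine ⟨by rw [hc, hG], Finset.eq_of_subset_of_card_le (fun n hn => ?_) (by simp)⟩
  rw [Finset.mem_range]
  by_contra! h
  refine hadd (n - (p + c)) p ?_ hp ?_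
  · rw [← hG, Finset.mem_range]
    omega
  · convert hn using 1
    omega

lemma two_mul_sum_of_eq_range {G : Finset ℕ} (h : G = Finset.range G.card) :
    2 * ∑ n ∈ G, (n : ℤ) ≤ G.card * (G.card - 1) := by
  have := two_mul_sum_le_of_range_subset (G := G) (p := G.card) (m := 0) h.ge h.le
  simpa using this

/-- The bound on the gaps in the residue classes 1 and 2 modulo 3: here `G₁` and `G₂` are the
gaps `3n + 1` and `3n + 2`, and `D` the gaps `3n`. -/
lemma nonzero_residue_gaps_bound {D G₁ G₂ : Finset ℕ} {m : ℕ} (hD : ∀ n ∈ D, n < m)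
    (hD₁ : ∀ a d, a ∉ G₁ → d ∉ D → a + d ∉ G₁) (hD₂ : ∀ a d, a ∉ G₂ → d ∉ D → a + d ∉ G₂)
    (h₁ : ∀ a b, a ∉ G₁ → b ∉ G₁ → a + b ∉ G₂)
    (h₂ : ∀ a b, a ∉ G₂ → b ∉ G₂ → a + b + 1 ∉ G₁)
    (hm : 18 * m ^ 2 ≤ G₁.card + G₂.card) :
    3 * (6 * ∑ n ∈ G₁, (n : ℤ) + 2 * G₁.card) + 3 * (6 * ∑ n ∈ G₂, (n : ℤ) + 4 * G₂.card) ≤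
      (G₁.card + G₂.card : ℤ) * (5 * (G₁.card + G₂.card) + 1) := by
  obtain ⟨p, hp, hpG, hpm⟩ := exists_initial_segment hD hD₁
  obtain ⟨q, hq, hqG, hqm⟩ := exists_initial_segment hD hD₂
  have hp' := Finset.card_le_card hpG
  have hq' := Finset.card_le_card hqG
  rw [Finset.card_range] at hp' hq'
  have hba := card_gaps_le_add (c := 0) hp h₁
  have hab := card_gaps_le_add (c := 1) hq h₂
  by_cases hx : G₂.card = 2 * G₁.card
  · obtain ⟨e₁, e₂⟩ := eq_range_of_card_eq (c := 0) hp hpG h₁ hx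
    have s₁ := two_mul_sum_of_eq_range e₁
    have s₂ := two_mul_sum_of_eq_range e₂
    zify at hx
    rw [hx] at s₂ ⊢
    nlinarith
  by_cases hy : G₁.card = 2 * G₂.card + 1
  · obtain ⟨e₂, e₁⟩ := eq_range_of_card_eq hq hqG h₂ hy
    have s₁ := two_mul_sum_of_eq_range e₁
    have s₂ := two_mul_sum_of_eq_range e₂
    zify at hy
    rw [hy] at s₁ ⊢
    nlinarith
  have s₁ := two_mul_sum_le_of_range_subset hpG hpm
  have s₂ := two_mul_sum_le_of_range_subset hqG hqm
  have hx' : (1 : ℤ) ≤ 2 * G₁.card - G₂.card := by omega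
  have hy' : (1 : ℤ) ≤ 2 * G₂.card + 1 - G₁.card := by omega
  have hxy := mul_nonneg (sub_nonneg.2 hx') (sub_nonneg.2 hy')
  zify at hm
  nlinarith

/-- The data of the gaps of a (3,γ)-hyperelliptic semigroup divisible by 3. -/
lemma IsNgammaHyperelliptic.multiples_of_three {γ : ℕ} {S : Set ℕ}
    (h : IsNgammaHyperelliptic 3 γ S) {G : Finset ℕ} (hG : ∀ n, n ∈ G ↔ 3 * n ∉ S) :
    (∀ a b, a ∉ G → b ∉ G → a + b ∉ G) ∧ G.card = γ ∧ ∀ n ∈ G, n < 2 * γ := by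
  obtain ⟨⟨hzero, hadd, -⟩, hcount, hdvd, hmem, hmem'⟩ := h
  have hG' : ∀ n, n ∉ G ↔ 3 * n ∈ S := fun n => by rw [hG, not_not]
  have haddG : ∀ a b, a ∉ G → b ∉ G → a + b ∉ G := by
    intro a b ha hb
    rw [hG'] at *
    rw [mul_add]
    exact hadd _ ha _ hb
  have hset : {s ∈ S | 0 < s ∧ s ≤ 2 * γ * 3} =
      (((Finset.Icc 1 (2 * γ)).filter (· ∉ G)).image (3 * ·) : Finset ℕ) := by
    ext s
    simp only [Set.mem_ofPred_eq, Finset.coe_image, Set.mem_image, Finset.mem_coe,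
      Finset.mem_filter, Finset.mem_Icc, hG']
    constructor
    · rintro ⟨hs, hpos, hle⟩
      obtain ⟨n, rfl⟩ := hdvd s hs hpos hle
      exact ⟨n, ⟨⟨by omega, by omega⟩, hs⟩, rfl⟩
    · rintro ⟨n, ⟨⟨h₁, h₂⟩, hs⟩, rfl⟩
      exact ⟨hs, by omega, by omega⟩
  rw [hset, Set.ncard_coe_finset, Finset.card_image_of_injective _
    (fun a b (hab : 3 * a = 3 * b) => by omega)] at hcount
  have hGpos : ∀ n ∈ G, 1 ≤ n := by
    intro n hn
    rcases Nat.eq_zero_or_pos n with rfl | h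
    · exact absurd hzero ((hG 0).1 hn)
    · exact h
  have hcard : (G.filter (· ≤ 2 * γ)).card = γ := by
    have hfil : G.filter (· ≤ 2 * γ) = (Finset.Icc 1 (2 * γ)).filter (· ∈ G) := by
      ext n
      simp only [Finset.mem_filter, Finset.mem_Icc]
      exact ⟨fun h => ⟨⟨hGpos n h.1, h.2⟩, h.1⟩, fun h => ⟨h.2, h.1.2⟩⟩
    have := Finset.card_filter_add_card_filter_not (s := Finset.Icc 1 (2 * γ)) (· ∈ G)
    rw [Nat.card_Icc] at this
    rw [hfil]
    omega
  have hle := gaps_le_two_mul haddG hcard ((hG' _).2 (by rwa [mul_comm]))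
  refine ⟨haddG, by rwa [Finset.filter_true_of_mem hle] at hcard, fun n hn => ?_⟩
  refine lt_of_le_of_ne (hle n hn) ?_
  rintro rfl
  exact (hG _).1 hn (by rwa [mul_comm])

lemma exists_residue_gaps {S : Set ℕ} (hS : Sᶜ.Finite) (i : ℕ) :
    ∃ G : Finset ℕ, ∀ n, n ∈ G ↔ 3 * n + i ∉ S := by
  have hinj : Function.Injective fun n => 3 * n + i := fun a b (h : 3 * a + i = 3 * b + i) => by
    omega
  exact ⟨(hS.preimage hinj.injOn).toFinset, fun n => by simp⟩

/-- The upper bound for the weight of (3,γ)-hyperelliptic semigroups of large genus. -/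
lemma IsNgammaHyperelliptic.six_mul_weight_le {γ : ℕ} {S : Set ℕ}
    (h : IsNgammaHyperelliptic 3 γ S) (hg : 72 * γ ^ 2 + γ ≤ genus S) :
    6 * weight S ≤ ((genus S : ℤ) - γ) * (5 * ((genus S : ℤ) - γ) + 1) + 18 * (γ : ℤ) ^ 2
      - 3 * (genus S : ℤ) * ((genus S : ℤ) + 1) := by
  obtain ⟨-, hadd, hfin⟩ := h.1
  obtain ⟨G₀, h₀⟩ := exists_residue_gaps hfin 0
  obtain ⟨G₁, h₁⟩ := exists_residue_gaps hfin 1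
  obtain ⟨G₂, h₂⟩ := exists_residue_gaps hfin 2
  simp only [add_zero] at h₀
  obtain ⟨hadd₀, hcard, hlt⟩ := h.multiples_of_three h₀
  obtain ⟨hgenus, hweight⟩ := genus_and_weight_of_residues hfin h₀ h₁ h₂
  have h₀' : ∀ n, n ∉ G₀ ↔ 3 * n ∈ S := fun n => by rw [h₀, not_not]
  have h₁' : ∀ n, n ∉ G₁ ↔ 3 * n + 1 ∈ S := fun n => by rw [h₁, not_not]
  have h₂' : ∀ n, n ∉ G₂ ↔ 3 * n + 2 ∈ S := fun n => by rw [h₂, not_not]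
  have hbound := nonzero_residue_gaps_bound (D := G₀) (G₁ := G₁) (G₂ := G₂) hlt
    (fun a d ha hd => by
      rw [h₁'] at *
      convert hadd _ ha _ ((h₀' d).1 hd) using 1
      ring)
    (fun a d ha hd => by
      rw [h₂'] at *
      convert hadd _ ha _ ((h₀' d).1 hd) using 1
      ring)
    (fun a b ha hb => by
      rw [h₁'] at ha hb
      rw [h₂']
      convert hadd _ ha _ hb using 1
      ring)
    (fun a b ha hb => by
      rw [h₂'] at ha hb
      rw [h₁']
      convert hadd _ ha _ hb using 1
      ring)
    (by rw [mul_pow]; omega)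
  have hsq : ∑ n ∈ G₀, (n : ℤ) ≤ (γ : ℤ) ^ 2 := by
    have := sum_gaps_le_card_sq hadd₀
    rw [hcard] at this
    zify at this
    exact this
  have hB : (genus S : ℤ) - γ = G₁.card + G₂.card := by
    rw [hgenus, hcard]
    push_cast
    ring
  rw [hB]
  linarith

/-- The semigroup whose elements divisible by 3 are thrice those of `⟨2, 2γ + 1⟩`, and which
contains `3n + 1` for `n ≥ a` and `3n + 2` for `n ≥ b`. -/
def extremalSemigroup (γ a b : ℕ) : Set ℕ :=
  {s | s % 3 = 0 ∧ (s % 2 = 0 ∨ 6 * γ ≤ s) ∨ s % 3 = 1 ∧ 3 * a ≤ s ∨ s % 3 = 2 ∧ 3 * b ≤ s}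

lemma mem_extremalSemigroup {γ a b s : ℕ} : s ∈ extremalSemigroup γ a b ↔
    s % 3 = 0 ∧ (s % 2 = 0 ∨ 6 * γ ≤ s) ∨ s % 3 = 1 ∧ 3 * a ≤ s ∨ s % 3 = 2 ∧ 3 * b ≤ s :=
  Iff.rfl

lemma extremalSemigroup_isNgammaHyperelliptic {γ a b : ℕ} (ha : 2 * γ ≤ a) (hb : 2 * γ ≤ b)
    (hba : b ≤ 2 * a) (hab : a ≤ 2 * b + 1) :
    IsNgammaHyperelliptic 3 γ (extremalSemigroup γ a b) := by
  refine ⟨⟨?_, ?_, ?_⟩, ?_, ?_, ?_, ?_⟩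
  · simp [mem_extremalSemigroup]
  · intro x hx y hy
    rw [mem_extremalSemigroup] at *
    omega
  · refine (Set.finite_Iio (3 * a + 3 * b)).subset fun s hs => ?_
    rw [Set.mem_compl_iff, mem_extremalSemigroup] at hs
    rw [Set.mem_Iio]
    omega
  · have hset : {s ∈ extremalSemigroup γ a b | 0 < s ∧ s ≤ 2 * γ * 3} =
        ((Finset.Icc 1 γ).image (6 * ·) : Finset ℕ) := by
      ext s
      simp only [Set.mem_ofPred_eq, Finset.coe_image, Set.mem_image, Finset.mem_coe,
        Finset.mem_Icc, mem_extremalSemigroup]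
      constructor
      · intro h
        exact ⟨s / 6, by omega, by omega⟩
      · rintro ⟨n, hn, rfl⟩
        omega
    rw [hset, Set.ncard_coe_finset, Finset.card_image_of_injective _
      (fun a b (hab : 6 * a = 6 * b) => by omega), Nat.card_Icc, Nat.add_sub_cancel]
  · intro s hs
    rw [mem_extremalSemigroup] at hs
    omega
  · rw [mem_extremalSemigroup]
    omega
  · rw [mem_extremalSemigroup]
    omega

lemma sum_range_odd (n : ℕ) : ∑ i ∈ Finset.range n, (2 * (i : ℤ) + 1) = n ^ 2 := by
  induction n with
  | zero => simp
  | succ n ih =>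
    rw [Finset.sum_range_succ, ih]
    push_cast
    ring

lemma extremalSemigroup_genus_and_weight {γ a b : ℕ} (hfin : (extremalSemigroup γ a b)ᶜ.Finite) :
    genus (extremalSemigroup γ a b) = γ + a + b ∧
    2 * weight (extremalSemigroup γ a b) = 6 * (γ : ℤ) ^ 2 + (3 * (a * (a - 1)) + 2 * a) +
      (3 * (b * (b - 1)) + 4 * b) - (γ + a + b) * (γ + a + b + 1) := by
  have hinj : Function.Injective fun i : ℕ => 2 * i + 1 :=
    fun a b (h : 2 * a + 1 = 2 * b + 1) => by omega
  obtain ⟨hg, hw⟩ := genus_and_weight_of_residues (S := extremalSemigroup γ a b)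
    (G₀ := (Finset.range γ).image fun i => 2 * i + 1) (G₁ := Finset.range a)
    (G₂ := Finset.range b) hfin
    (fun n => by
      simp only [Finset.mem_image, Finset.mem_range, mem_extremalSemigroup]
      constructor
      · rintro ⟨i, hi, rfl⟩
        omega
      · intro h
        exact ⟨n / 2, by omega, by omega⟩)
    (fun n => by
      rw [Finset.mem_range, mem_extremalSemigroup]
      omega)
    (fun n => by
      rw [Finset.mem_range, mem_extremalSemigroup]
      omega)
  rw [Finset.card_image_of_injective _ hinj] at hg
  simp only [Finset.card_range] at hg hw
  refine ⟨hg, ?_⟩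
  have hodd := sum_range_odd γ
  have h₁ := two_mul_sum_range a
  have h₂ := two_mul_sum_range b
  rw [hw, hg, Finset.sum_image hinj.injOn]
  push_cast
  linarith

/-- for g ≫ γ with (g−γ) mod 3 ≠ 2, the maximal weight W of a
(3,γ)-hyperelliptic semigroup of genus g is attained and satisfies
6W = B(5B+1) + 18γ² − 3g(g+1), where B = g − γ. -/
theorem stmt13 (γ : ℕ) :
    ∃ g₀ : ℕ, ∀ g ≥ g₀, ((g : ℤ) - γ) % 3 ≠ 2 →
      ∃ S : Set ℕ, IsNgammaHyperelliptic 3 γ S ∧ genus S = g ∧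
        (∀ T : Set ℕ, IsNgammaHyperelliptic 3 γ T → genus T = g →
          weight T ≤ weight S) ∧
        6 * weight S =
          ((g : ℤ) - γ) * (5 * ((g : ℤ) - γ) + 1) + 18 * (γ : ℤ) ^ 2
            - 3 * (g : ℤ) * ((g : ℤ) + 1) := by
  refine ⟨72 * γ ^ 2 + 10 * γ + 10, fun g hg hmod => ?_⟩
  obtain ⟨a, b, ha, hb, hsum, hcase⟩ : ∃ a b : ℕ, 2 * γ ≤ a ∧ 2 * γ ≤ b ∧ γ + a + b = g ∧
      (b = 2 * a ∨ a = 2 * b + 1) := by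
    have hle : 10 * γ + 10 ≤ g := le_trans (by omega) hg
    by_cases h : ((g : ℤ) - γ) % 3 = 0
    · exact ⟨(g - γ) / 3, 2 * ((g - γ) / 3), by omega, by omega, by omega, by omega⟩
    · exact ⟨2 * ((g - γ) / 3) + 1, (g - γ) / 3, by omega, by omega, by omega, by omega⟩
  have hS := extremalSemigroup_isNgammaHyperelliptic ha hb (by omega) (by omega)
  obtain ⟨hgenus, hweight⟩ := extremalSemigroup_genus_and_weight hS.1.2.2
  have hmax : 6 * weight (extremalSemigroup γ a b) =
      ((g : ℤ) - γ) * (5 * ((g : ℤ) - γ) + 1) + 18 * (γ : ℤ) ^ 2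
        - 3 * (g : ℤ) * ((g : ℤ) + 1) := by
    have h6 : ∀ w : ℤ, 6 * w = 3 * (2 * w) := fun w => by ring
    rw [h6, hweight, ← hsum]
    rcases hcase with rfl | rfl <;> push_cast <;> ring
  refine ⟨_, hS, hgenus.trans hsum, fun T hT hTg => ?_, hmax⟩
  have := hT.six_mul_weight_le (by omega)
  rw [hTg] at this
  linarith
end

section
/- Let N ≥ 3 be prime and γ ≥ 0. There exists g₀ (depending on N and γ) such that for every g ≥ g₀ with (N−1)/2 dividing g − γ and (2(g−γ)/(N−1)) mod N ≠ N−1, the semigroup S_N has genus g, i.e. #(ℕ ∖ S_N) = g. -/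
/-- u₁ = 2(g−γ)/(N−1) + 1. -/
def u1N (N γ g : ℕ) : ℕ := 2 * (g - γ) / (N - 1) + 1

/-- The semigroup S_N = N⟨2, 2γ+1⟩ + ⟨u₁, u₁+N⟩, i.e. the submonoid of ℕ
generated by {2N, (2γ+1)N, u₁, u₁+N}. -/
def SN (N γ g : ℕ) : Set ℕ :=
  (AddSubmonoid.closure
    ({2 * N, (2 * γ + 1) * N, u1N N γ g, u1N N γ g + N} : Set ℕ) : AddSubmonoid ℕ)

theorem mem_SN_iff {N γ g x : ℕ} :
    x ∈ SN N γ g ↔ ∃ a b c d : ℕ, x = a * (2 * N) + b * ((2 * γ + 1) * N) +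
      c * u1N N γ g + d * (u1N N γ g + N) := by
  constructor
  · intro hx
    refine AddSubmonoid.closure_induction ?_ ?_ ?_ hx
    · rintro y (rfl | rfl | rfl | rfl)
      · exact ⟨1, 0, 0, 0, by ring⟩
      · exact ⟨0, 1, 0, 0, by ring⟩
      · exact ⟨0, 0, 1, 0, by ring⟩
      · exact ⟨0, 0, 0, 1, by ring⟩
    · exact ⟨0, 0, 0, 0, by ring⟩
    · rintro y z - - ⟨a, b, c, d, rfl⟩ ⟨a', b', c', d', rfl⟩
      exact ⟨a + a', b + b', c + c', d + d', by ring⟩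
  · rintro ⟨a, b, c, d, rfl⟩
    have hgen : ∀ (n : ℕ) {y : ℕ}, y ∈ ({2 * N, (2 * γ + 1) * N, u1N N γ g,
        u1N N γ g + N} : Set ℕ) → n * y ∈ AddSubmonoid.closure ({2 * N, (2 * γ + 1) * N,
        u1N N γ g, u1N N γ g + N} : Set ℕ) := fun n y hy => by
      simpa using nsmul_mem (AddSubmonoid.subset_closure hy) n
    exact add_mem (add_mem (add_mem (hgen a (by simp)) (hgen b (by simp)))
      (hgen c (by simp))) (hgen d (by simp))

theorem mul_add_mul_mem_SN {N γ g k : ℕ} (hk : 1 ≤ k) (t : ℕ) :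
    k * u1N N γ g + N * t ∈ SN N γ g := by
  obtain ⟨k, rfl⟩ := Nat.exists_eq_add_of_le' hk
  rw [mem_SN_iff]
  obtain ⟨a, rfl | rfl⟩ := Nat.even_or_odd' t
  · exact ⟨a, 0, k + 1, 0, by ring⟩
  · exact ⟨a, 0, k, 1, by ring⟩

/-- The elements of `SN` in the residue class of `k * u1N` modulo `N` are at least `k * u1N`. -/
theorem mul_le_of_mem_SN {N γ g k x : ℕ} (hcop : N.Coprime (u1N N γ g)) (hk : k < N)
    (hx : x ∈ SN N γ g) (hmod : x ≡ k * u1N N γ g [MOD N]) : k * u1N N γ g ≤ x := by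
  obtain ⟨a, b, c, d, rfl⟩ := mem_SN_iff.1 hx
  have hcd : a * (2 * N) + b * ((2 * γ + 1) * N) + c * u1N N γ g + d * (u1N N γ g + N)
      = (c + d) * u1N N γ g + N * (2 * a + b * (2 * γ + 1) + d) := by ring
  rw [hcd] at hmod ⊢
  have hmod' : (c + d) * u1N N γ g ≡ k * u1N N γ g [MOD N] := by
    simpa [Nat.ModEq] using hmod
  have hle : k ≤ c + d := by
    have := Nat.ModEq.cancel_right_of_coprime hcop hmod'
    rw [Nat.ModEq, Nat.mod_eq_of_lt hk] at this
    exact this ▸ Nat.mod_le _ _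
  exact (Nat.mul_le_mul_right _ hle).trans (Nat.le_add_right _ _)

theorem mul_odd_notMem_SN {N γ g j : ℕ} (hN : 0 < N) (hcop : N.Coprime (u1N N γ g))
    (hu : 2 * γ ≤ u1N N γ g) (hj : j < γ) : N * (2 * j + 1) ∉ SN N γ g := by
  intro hx
  obtain ⟨a, b, c, d, h⟩ := mem_SN_iff.1 hx
  have h' : N * (2 * j + 1) = (c + d) * u1N N γ g + N * (2 * a + b * (2 * γ + 1) + d) := by
    rw [h]; ring
  have hdvd : N ∣ c + d := by
    have : N ∣ (c + d) * u1N N γ g :=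
      (Nat.dvd_add_left (Dvd.intro _ rfl)).1 (h' ▸ Dvd.intro _ rfl)
    exact hcop.dvd_of_dvd_mul_right this
  obtain ⟨m, hm⟩ := hdvd
  rw [hm, mul_assoc, ← mul_add] at h'
  have h2 := Nat.eq_of_mul_eq_mul_left hN h'
  rcases Nat.eq_zero_or_pos m with rfl | hm0
  · have hd : d = 0 := by simp at hm; omega
    subst hd
    rcases Nat.eq_zero_or_pos b with rfl | hb
    · omega
    · have := Nat.le_mul_of_pos_left (2 * γ + 1) hb
      omega
  · have := Nat.le_mul_of_pos_left (u1N N γ g) hm0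
    omega

/-- The gaps of `SN`, listed by residue class modulo `N`. -/
theorem compl_SN_eq {N γ g : ℕ} (hN : 0 < N) (hcop : N.Coprime (u1N N γ g))
    (hu : 2 * γ ≤ u1N N γ g) :
    (SN N γ g)ᶜ = (((Finset.range γ).image fun j => N * (2 * j + 1)) ∪
      (Finset.range (N - 1)).biUnion fun k => (Finset.range ((k + 1) * u1N N γ g / N)).image
        fun t => (k + 1) * u1N N γ g % N + N * t : Finset ℕ) := by
  ext x
  simp only [Set.mem_compl_iff, Finset.coe_union, Set.mem_union, Finset.mem_coe,
    Finset.mem_image, Finset.mem_biUnion, Finset.mem_range]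
  constructor
  · intro hx
    obtain ⟨k, hkN, hk⟩ : ∃ k < N, k * u1N N γ g ≡ x [MOD N] := by
      obtain ⟨y, -, hy⟩ := Nat.exists_mul_mod_eq_of_coprime x hcop.symm hN.ne'
      refine ⟨y % N, Nat.mod_lt _ hN, ?_⟩
      rw [Nat.ModEq, Nat.mod_mul_mod, mul_comm]
      exact hy
    rcases Nat.eq_zero_or_pos k with rfl | hk0
    · left
      obtain ⟨y, rfl⟩ : N ∣ x := by
        rw [zero_mul] at hk
        exact (Nat.modEq_zero_iff_dvd).1 hk.symm
      obtain ⟨j, rfl | rfl⟩ := Nat.even_or_odd' y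
      · exact absurd (mem_SN_iff.2 ⟨j, 0, 0, 0, by ring⟩) hx
      · refine ⟨j, ?_, rfl⟩
        by_contra! hj
        obtain ⟨i, rfl⟩ := Nat.exists_eq_add_of_le hj
        exact hx (mem_SN_iff.2 ⟨i, 1, 0, 0, by ring⟩)
    · right
      obtain ⟨k, rfl⟩ := Nat.exists_eq_add_of_le' hk0
      have hlt : x < (k + 1) * u1N N γ g := by
        by_contra! hle
        obtain ⟨t, ht⟩ := (Nat.modEq_iff_dvd' hle).1 hk
        apply hx
        rw [show x = (k + 1) * u1N N γ g + N * t by omega]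
        exact mul_add_mul_mem_SN hk0 t
      refine ⟨k, by omega, x / N, ?_, ?_⟩
      · have h1 := Nat.mod_add_div x N
        have h2 := Nat.mod_add_div ((k + 1) * u1N N γ g) N
        rw [hk] at h2
        exact Nat.lt_of_mul_lt_mul_left (a := N) (by omega)
      · rw [hk]
        exact Nat.mod_add_div x N
  · rintro (⟨j, hj, rfl⟩ | ⟨k, hk, t, ht, rfl⟩) hx
    · exact mul_odd_notMem_SN hN hcop hu hj hx
    · have hle := mul_le_of_mem_SN hcop (k := k + 1) (by omega) hx (by simp [Nat.ModEq])
      have h2 := Nat.mod_add_div ((k + 1) * u1N N γ g) N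
      have h3 := Nat.mul_lt_mul_of_pos_left ht hN
      omega

theorem mul_div_add_mul_div_of_coprime {N u a b : ℕ} (hcop : N.Coprime u) (ha : 0 < a)
    (hb : 0 < b) (hab : a + b = N) : a * u / N + b * u / N = u - 1 := by
  have hN : 0 < N := by omega
  have hsum : a * u + b * u = N * u := by rw [← add_mul, hab]
  have h1 := Nat.mod_add_div (a * u) N
  have h2 := Nat.mod_add_div (b * u) N
  have h3 := Nat.mod_lt (a * u) hN
  have h4 := Nat.mod_lt (b * u) hN
  have h0 : 0 < a * u % N := by
    refine Nat.pos_of_ne_zero fun h => ?_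
    have := Nat.le_of_dvd ha (hcop.dvd_of_dvd_mul_right (Nat.dvd_of_mod_eq_zero h))
    omega
  have hlt : N * (a * u / N + b * u / N) < N * u := by rw [mul_add]; omega
  have hgt : N * u < N * (a * u / N + b * u / N + 2) := by
    simp only [mul_add]; omega
  have hlt' : a * u / N + b * u / N < u := Nat.lt_of_mul_lt_mul_left hlt
  have hgt' : u < a * u / N + b * u / N + 2 := Nat.lt_of_mul_lt_mul_left hgt
  exact (Nat.sub_eq_of_eq_add (le_antisymm (Nat.le_of_lt_succ hgt') hlt')).symm

theorem two_mul_sum_mul_div_of_coprime {N u : ℕ} (hcop : N.Coprime u) :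
    2 * ∑ k ∈ Finset.range (N - 1), (k + 1) * u / N = (N - 1) * (u - 1) := by
  rw [two_mul]
  nth_rewrite 2 [← Finset.sum_range_reflect]
  rw [← Finset.sum_add_distrib, Finset.sum_congr rfl (g := fun _ => u - 1)]
  · simp
  · intro k hk
    rw [Finset.mem_range] at hk
    exact mul_div_add_mul_div_of_coprime hcop (by omega) (by omega) (by omega)

theorem ncard_compl_SN {N γ g : ℕ} (hN : 0 < N) (hcop : N.Coprime (u1N N γ g))
    (hu : 2 * γ ≤ u1N N γ g) :
    ((SN N γ g)ᶜ).ncard = γ + ∑ k ∈ Finset.range (N - 1), (k + 1) * u1N N γ g / N := by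
  have hmod : ∀ k < N, ∀ l < N, k * u1N N γ g ≡ l * u1N N γ g [MOD N] → k = l :=
    fun k hk l hl h =>
      (Nat.ModEq.cancel_right_of_coprime hcop h).eq_of_lt_of_lt hk hl
  rw [compl_SN_eq hN hcop hu, Set.ncard_coe_finset, Finset.card_union_of_disjoint,
    Finset.card_biUnion]
  · congr 1
    · rw [Finset.card_image_of_injective, Finset.card_range]
      intro i j hij
      have := Nat.eq_of_mul_eq_mul_left hN hij
      omega
    · refine Finset.sum_congr rfl fun k _ => ?_
      rw [Finset.card_image_of_injective, Finset.card_range]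
      intro i j hij
      exact Nat.eq_of_mul_eq_mul_left hN (Nat.add_left_cancel hij)
  · intro k hk l hl hkl
    rw [Finset.mem_coe, Finset.mem_range] at hk hl
    rw [Function.onFun, Finset.disjoint_left]
    intro x hx hx'
    obtain ⟨s, -, rfl⟩ := Finset.mem_image.1 hx
    obtain ⟨t, -, h⟩ := Finset.mem_image.1 hx'
    have := congrArg (· % N) h
    simp only [Nat.add_mul_mod_self_left, Nat.mod_mod] at this
    have := hmod (l + 1) (by omega) (k + 1) (by omega) this
    omega
  · rw [Finset.disjoint_left]
    intro x hx hx'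
    obtain ⟨j, -, rfl⟩ := Finset.mem_image.1 hx
    obtain ⟨k, hk, hx'⟩ := Finset.mem_biUnion.1 hx'
    rw [Finset.mem_range] at hk
    obtain ⟨t, -, h⟩ := Finset.mem_image.1 hx'
    have := congrArg (· % N) h
    simp only [Nat.add_mul_mod_self_left, Nat.mod_mod, Nat.mul_mod_right] at this
    have := hmod (k + 1) (by omega) 0 hN (by simpa [Nat.ModEq] using this)
    omega

/-- S_N has genus g. -/
theorem stmt14 (N γ : ℕ) (hN : N.Prime) (hN3 : 3 ≤ N) :
    ∃ g₀ : ℕ, ∀ g ≥ g₀,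
      (N - 1) / 2 ∣ (g - γ) →
      (2 * (g - γ) / (N - 1)) % N ≠ N - 1 →
      ((SN N γ g)ᶜ).ncard = g := by
  refine ⟨γ + γ * (N - 1), fun g hg hdvd hmod => ?_⟩
  obtain ⟨m, hm⟩ : ∃ m, N = 2 * m + 1 := hN.odd_of_ne_two (by omega)
  obtain ⟨d, hd⟩ := hdvd
  rw [show (N - 1) / 2 = m by omega] at hd
  have hN1 : N - 1 = 2 * m := by omega
  have hdiv : 2 * (g - γ) / (N - 1) = d := by
    rw [hd, hN1, ← mul_assoc, Nat.mul_div_cancel_left _ (by omega)]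
  have hu1 : u1N N γ g = d + 1 := by rw [u1N, hdiv]
  rw [hdiv] at hmod
  have hcop : N.Coprime (u1N N γ g) := by
    rw [hN.coprime_iff_not_dvd, hu1]
    rintro ⟨e, he⟩
    apply hmod
    obtain ⟨e, rfl⟩ : ∃ f, e = f + 1 := Nat.exists_eq_succ_of_ne_zero (by rintro rfl; omega)
    rw [show d = (N - 1) + N * e by rw [mul_add] at he; omega, Nat.add_mul_mod_self_left]
    exact Nat.mod_eq_of_lt (by omega)
  have hu : 2 * γ ≤ u1N N γ g := by
    have : m * (2 * γ) ≤ m * d := by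
      rw [← hd, show m * (2 * γ) = γ * (N - 1) by rw [hN1]; ring]
      omega
    have := Nat.le_of_mul_le_mul_left this (by omega)
    omega
  have hsum := two_mul_sum_mul_div_of_coprime hcop
  rw [ncard_compl_SN hN.pos hcop hu]
  rw [show (N - 1) * (u1N N γ g - 1) = 2 * (g - γ) by
    rw [hu1, hd, hN1, Nat.add_sub_cancel, mul_assoc]] at hsum
  have : γ ≤ g := (Nat.le_add_right _ _).trans hg
  omega
end

section
/- Let N ≥ 3 be prime and γ ≥ 1. There exists g₀ (depending on N and γ) such that for every g ≥ g₀ with (N−1)/2 dividing both g and γ, (2(g−γ)/(N−1)) mod N ≠ N−1 and (2g/(N−1)) mod N ≠ N−1, one has W_{S_N} > W_{S_N^*}. -/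
/-- u₁* = 2(g−Nγ)/(N−1) + 1. -/
def u1star (N γ g : ℕ) : ℕ := 2 * (g - N * γ) / (N - 1) + 1

/-- The Carvalho–Torres semigroup S_N* = N⟨2, 2γ+1⟩ + ⟨u₁*⟩, i.e. the submonoid
of ℕ generated by {2N, (2γ+1)N, u₁*}. -/
def SNstar (N γ g : ℕ) : Set ℕ :=
  (AddSubmonoid.closure
    ({2 * N, (2 * γ + 1) * N, u1star N γ g} : Set ℕ) : AddSubmonoid ℕ)

open Finset in
/-- Multiplication by `v` coprime to `N` permutes the residues modulo `N`. -/
theorem image_mul_mod_range {N v : ℕ} (hN : 0 < N) (hv : N.Coprime v) :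
    (range N).image (fun j => j * v % N) = range N := by
  apply eq_of_subset_of_card_le
  · intro x hx
    obtain ⟨j, -, rfl⟩ := mem_image.1 hx
    exact mem_range.2 (Nat.mod_lt _ hN)
  · rw [card_image_of_injOn]
    intro a ha b hb hab
    have h : a ≡ b [MOD N] := Nat.ModEq.cancel_right_of_coprime hv hab
    exact h.eq_of_lt_of_lt (mem_range.1 ha) (mem_range.1 hb)

theorem eq_of_mul_mod_eq {N v a b : ℕ} (hv : N.Coprime v) (ha : a < N) (hb : b < N)
    (hab : a * v % N = b * v % N) : a = b :=
  (Nat.ModEq.cancel_right_of_coprime hv hab : a ≡ b [MOD N]).eq_of_lt_of_lt ha hb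

open Finset in
theorem sum_mul_mod_range {N v : ℕ} (hN : 0 < N) (hv : N.Coprime v) (f : ℕ → ℤ) :
    ∑ j ∈ range N, f (j * v % N) = ∑ j ∈ range N, f j := by
  conv_rhs => rw [← image_mul_mod_range hN hv]
  rw [sum_image]
  intro a ha b hb hab
  exact eq_of_mul_mod_eq hv (mem_range.1 ha) (mem_range.1 hb) hab

/-- The numbers `j v + t N` with `j < N`, where `t ∈ ⟨2, 2γ+1⟩` is required when `j ∈ J`. -/
def layeredSet (N γ v : ℕ) (J : Finset ℕ) : Set ℕ :=
  {x | ∃ j < N, ∃ t, (j ∉ J ∨ Even t ∨ 2 * γ < t) ∧ x = j * v + t * N}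

open Finset in
/-- The numbers congruent to `j v` modulo `N` that are missing from `layeredSet N γ v J`. -/
def layerGaps (N γ v : ℕ) (J : Finset ℕ) (j : ℕ) : Finset ℕ :=
  (range (j * v / N)).image (fun i => j * v % N + i * N) ∪
    if j ∈ J then (range γ).image (fun i => j * v + (2 * i + 1) * N) else ∅

theorem mod_of_mem_layerGaps {N γ v : ℕ} {J : Finset ℕ} {j x : ℕ}
    (hx : x ∈ layerGaps N γ v J j) : x % N = j * v % N := by
  unfold layerGaps at hx
  split_ifs at hx with h
  · rcases Finset.mem_union.1 hx with hx | hx <;>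
      obtain ⟨i, -, rfl⟩ := Finset.mem_image.1 hx <;> simp
  · rw [Finset.union_empty] at hx
    obtain ⟨i, -, rfl⟩ := Finset.mem_image.1 hx
    simp

theorem compl_layeredSet {N γ v : ℕ} (J : Finset ℕ) (hN : 0 < N) (hv : N.Coprime v) :
    (layeredSet N γ v J)ᶜ = ↑((Finset.range N).biUnion (layerGaps N γ v J)) := by
  ext x
  simp only [Set.mem_compl_iff, Finset.coe_biUnion, Set.mem_iUnion, Finset.mem_coe,
    Finset.mem_range, exists_prop]
  constructor
  · intro hx
    have hmem : x % N ∈ (Finset.range N).image (fun j => j * v % N) := by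
      rw [image_mul_mod_range hN hv]
      exact Finset.mem_range.2 (Nat.mod_lt _ hN)
    obtain ⟨j, hj, hjx⟩ := Finset.mem_image.1 hmem
    have hj := Finset.mem_range.1 hj
    refine ⟨j, hj, ?_⟩
    rw [layerGaps, Finset.mem_union]
    rcases lt_or_ge x (j * v) with hlt | hge
    · left
      refine Finset.mem_image.2 ⟨x / N, Finset.mem_range.2 ?_, ?_⟩
      · have h1 := Nat.div_add_mod x N
        have h2 := Nat.div_add_mod (j * v) N
        refine lt_of_mul_lt_mul_left (a := N) ?_ (Nat.zero_le _)
        omega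
      · simp only [hjx]
        rw [mul_comm]
        exact Nat.mod_add_div x N
    · right
      obtain ⟨t, ht⟩ := (Nat.modEq_iff_dvd' hge).1 hjx
      have hxt : x = j * v + t * N := by rw [mul_comm t]; omega
      have hnot : ¬ (j ∉ J ∨ Even t ∨ 2 * γ < t) := fun h => hx ⟨j, hj, t, h, hxt⟩
      push Not at hnot
      obtain ⟨hJ, hodd, hle⟩ := hnot
      obtain ⟨i, rfl⟩ := Nat.not_even_iff_odd.1 hodd
      rw [if_pos hJ]
      exact Finset.mem_image.2 ⟨i, Finset.mem_range.2 (by omega), hxt.symm⟩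
  · rintro ⟨j, hj, hx⟩ ⟨k, hk, t, ht, hxt⟩
    have hmod := mod_of_mem_layerGaps hx
    have hjk : j = k := by
      apply eq_of_mul_mod_eq hv hj hk
      rw [← hmod, hxt]
      simp
    subst hjk
    rw [layerGaps, Finset.mem_union] at hx
    rcases hx with hx | hx
    · obtain ⟨i, hi, hix⟩ := Finset.mem_image.1 hx
      have hi := Finset.mem_range.1 hi
      have h2 := Nat.div_add_mod (j * v) N
      have h3 : i * N < N * (j * v / N) := by
        rw [mul_comm]; exact Nat.mul_lt_mul_of_pos_left hi hN
      omega
    · split_ifs at hx with hJ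
      · obtain ⟨i, hi, hix⟩ := Finset.mem_image.1 hx
        have hi := Finset.mem_range.1 hi
        have h4 : (2 * i + 1) * N = t * N := by omega
        have h5 := Nat.eq_of_mul_eq_mul_right hN h4
        subst h5
        rcases ht with h | h | h
        · exact h hJ
        · exact Nat.not_even_two_mul_add_one i h
        · omega
      · simp at hx

open Finset in
theorem sum_gaps_layeredSet {N γ v : ℕ} {J : Finset ℕ} (hN : 0 < N) (hv : N.Coprime v)
    (hJ : J ⊆ range N) (f : ℕ → ℤ) :
    ∑ x ∈ (range N).biUnion (layerGaps N γ v J), f x =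
      ∑ j ∈ range N, ∑ i ∈ range (j * v / N), f (j * v % N + i * N) +
        ∑ j ∈ J, ∑ i ∈ range γ, f (j * v + (2 * i + 1) * N) := by
  rw [sum_biUnion]
  · have hsub : ∑ j ∈ J, ∑ i ∈ range γ, f (j * v + (2 * i + 1) * N) =
        ∑ j ∈ range N, if j ∈ J then ∑ i ∈ range γ, f (j * v + (2 * i + 1) * N) else 0 := by
      rw [sum_ite_mem, inter_eq_right.2 hJ]
    rw [hsub, ← sum_add_distrib]
    refine sum_congr rfl fun j _ => ?_
    rw [layerGaps, sum_union]
    · congr 1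
      · rw [sum_image]
        intro a _ b _ hab
        exact Nat.eq_of_mul_eq_mul_right hN (Nat.add_left_cancel hab)
      · split_ifs
        · rw [sum_image]
          intro a _ b _ hab
          have := Nat.eq_of_mul_eq_mul_right hN
            (show (2 * a + 1) * N = (2 * b + 1) * N from Nat.add_left_cancel hab)
          omega
        · simp
    · split_ifs
      · rw [disjoint_left]
        intro x hx hx'
        obtain ⟨i, hi, rfl⟩ := mem_image.1 hx
        obtain ⟨k, hk, hik⟩ := mem_image.1 hx'
        have h2 := Nat.div_add_mod (j * v) N
        have h3 : i * N < N * (j * v / N) := by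
          rw [mul_comm]; exact Nat.mul_lt_mul_of_pos_left (mem_range.1 hi) hN
        omega
      · exact disjoint_empty_right _
  · intro a ha b hb hab
    refine disjoint_left.2 fun x hx hx' => hab ?_
    apply eq_of_mul_mod_eq hv (mem_range.1 ha) (mem_range.1 hb)
    rw [← mod_of_mem_layerGaps hx, mod_of_mem_layerGaps hx']

open Finset in
theorem two_mul_sum_arith (q : ℕ) (r d : ℤ) :
    2 * ∑ i ∈ range q, (r + i * d) = 2 * q * r + d * q * (q - 1) := by
  induction q with
  | zero => simp
  | succ n ih =>
    rw [sum_range_succ, mul_add, ih]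
    push_cast
    ring

open Finset in
theorem sum_odd_multiples (n : ℕ) (x d : ℤ) :
    ∑ i ∈ range n, (x + (2 * i + 1) * d) = n * x + d * n ^ 2 := by
  induction n with
  | zero => simp
  | succ n ih =>
    rw [sum_range_succ, ih]
    push_cast
    ring

open Finset in
theorem mul_sum_div {N v : ℕ} (hN : 0 < N) (hv : N.Coprime v) :
    (N : ℤ) * ∑ j ∈ range N, ((j * v / N : ℕ) : ℤ) = (v - 1) * ∑ j ∈ range N, (j : ℤ) := by
  have hr := sum_mul_mod_range hN hv (fun j => (j : ℤ))
  rw [sub_mul, one_mul]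
  nth_rw 2 [← hr]
  rw [mul_sum, mul_sum, ← sum_sub_distrib]
  refine sum_congr rfl fun j _ => ?_
  have h : (N : ℤ) * ((j * v / N : ℕ) : ℤ) + ((j * v % N : ℕ) : ℤ) = j * v := by
    exact_mod_cast Nat.div_add_mod (j * v) N
  linarith

open Finset in
theorem mul_sum_lower_gaps {N v : ℕ} (hN : 0 < N) (hv : N.Coprime v) :
    2 * (N : ℤ) * ∑ j ∈ range N, ∑ i ∈ range (j * v / N), ((j * v % N + i * N : ℕ) : ℤ) =
      (v ^ 2 - 1) * ∑ j ∈ range N, (j : ℤ) ^ 2 - N * ((v - 1) * ∑ j ∈ range N, (j : ℤ)) := by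
  have hr := sum_mul_mod_range hN hv (fun j => (j : ℤ) ^ 2)
  rw [← mul_sum_div hN hv, sub_mul, one_mul]
  nth_rw 2 [← hr]
  rw [mul_sum, mul_sum, mul_sum, mul_sum, ← sum_sub_distrib, ← sum_sub_distrib]
  refine sum_congr rfl fun j _ => ?_
  have h : (N : ℤ) * ((j * v / N : ℕ) : ℤ) + ((j * v % N : ℕ) : ℤ) = j * v := by
    exact_mod_cast Nat.div_add_mod (j * v) N
  have hs := two_mul_sum_arith (j * v / N) ((j * v % N : ℕ) : ℤ) N
  simp only [Nat.cast_add, Nat.cast_mul (_ : ℕ) N]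
  generalize ((j * v / N : ℕ) : ℤ) = q at *
  generalize ((j * v % N : ℕ) : ℤ) = r at *
  have hv2 : (v : ℤ) ^ 2 * j ^ 2 = (N * q + r) ^ 2 := by rw [h]; ring
  rw [hv2]
  linear_combination (N : ℤ) * hs

open Finset in
theorem mul_genus_layeredSet {N γ v : ℕ} {J : Finset ℕ} (hN : 0 < N) (hv : N.Coprime v)
    (hJ : J ⊆ range N) :
    (N : ℤ) * genus (layeredSet N γ v J) =
      (v - 1) * ∑ j ∈ range N, (j : ℤ) + N * (#J * γ) := by
  rw [genus, compl_layeredSet J hN hv, Set.ncard_coe_finset, card_eq_sum_ones, Nat.cast_sum,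
    sum_gaps_layeredSet hN hv hJ (fun _ => ((1 : ℕ) : ℤ)), mul_add, ← mul_sum_div hN hv]
  simp

open Finset in
theorem mul_sum_compl_layeredSet {N γ v : ℕ} {J : Finset ℕ} (hN : 0 < N) (hv : N.Coprime v)
    (hJ : J ⊆ range N) :
    2 * (N : ℤ) * ∑ᶠ ℓ ∈ (layeredSet N γ v J)ᶜ, (ℓ : ℤ) =
      (v ^ 2 - 1) * ∑ j ∈ range N, (j : ℤ) ^ 2 - N * ((v - 1) * ∑ j ∈ range N, (j : ℤ)) +
        2 * N * (γ * v * ∑ j ∈ J, (j : ℤ) + #J * (N * γ ^ 2)) := by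
  rw [compl_layeredSet J hN hv, finsum_mem_coe_finset,
    sum_gaps_layeredSet hN hv hJ (fun x => (x : ℤ)), mul_add, mul_sum_lower_gaps hN hv]
  congr 2
  have h : ∀ j ∈ J, ∑ i ∈ range γ, ((j * v + (2 * i + 1) * N : ℕ) : ℤ) =
      γ * v * j + N * γ ^ 2 := by
    intro j _
    have := sum_odd_multiples γ (j * v : ℤ) N
    push_cast
    rw [this]
    ring
  rw [sum_congr rfl h, sum_add_distrib, mul_sum, sum_const, nsmul_eq_mul]

theorem add_mem_layeredSet {N γ v : ℕ} {J : Finset ℕ} (hJ : IsLowerSet (J : Set ℕ))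
    (hv : 2 * γ < v) {x y : ℕ} (hx : x ∈ layeredSet N γ v J) (hy : y ∈ layeredSet N γ v J) :
    x + y ∈ layeredSet N γ v J := by
  obtain ⟨j, hj, s, hs, rfl⟩ := hx
  obtain ⟨k, hk, t, ht, rfl⟩ := hy
  rcases lt_or_ge (j + k) N with h | h
  · refine ⟨j + k, h, s + t, ?_, by ring⟩
    by_cases hjk : j + k ∈ J
    · right
      have hjJ : j ∈ J := hJ (Nat.le_add_right j k) hjk
      have hkJ : k ∈ J := hJ (Nat.le_add_left k j) hjk
      rcases hs with hs | hs | hs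
      · exact absurd hjJ hs
      · rcases ht with ht | ht | ht
        · exact absurd hkJ ht
        · exact Or.inl (hs.add ht)
        · right; omega
      · right; omega
    · exact Or.inl hjk
  · obtain ⟨i, hi⟩ := Nat.exists_eq_add_of_le h
    refine ⟨i, by omega, s + t + v, Or.inr (Or.inr (by omega)), ?_⟩
    calc j * v + s * N + (k * v + t * N) = (j + k) * v + (s + t) * N := by ring
      _ = i * v + (s + t + v) * N := by rw [hi]; ring

theorem closure_le_layeredSet {N γ v : ℕ} {J : Finset ℕ} (hN : 0 < N)
    (hJ : IsLowerSet (J : Set ℕ)) (hv : 2 * γ < v) {A : Set ℕ}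
    (hA : A ⊆ layeredSet N γ v J) : (AddSubmonoid.closure A : Set ℕ) ⊆ layeredSet N γ v J := by
  intro x hx
  induction hx using AddSubmonoid.closure_induction with
  | mem x hx => exact hA hx
  | zero => exact ⟨0, hN, 0, by simp, by simp⟩
  | add x y _ _ hx hy => exact add_mem_layeredSet hJ hv hx hy

theorem mul_mem_of_even_or_lt {N γ t : ℕ} {M : AddSubmonoid ℕ} (h2 : 2 * N ∈ M)
    (hodd : (2 * γ + 1) * N ∈ M) (ht : Even t ∨ 2 * γ < t) : t * N ∈ M := by
  rcases Nat.even_or_odd' t with ⟨s, rfl | rfl⟩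
  · rw [show 2 * s * N = s • (2 * N) by rw [smul_eq_mul]; ring]
    exact M.nsmul_mem h2 s
  · have hs : γ ≤ s := by
      rcases ht with ht | ht
      · exact absurd ht (Nat.not_even_two_mul_add_one s)
      · omega
    obtain ⟨d, rfl⟩ := Nat.exists_eq_add_of_le hs
    rw [show (2 * (γ + d) + 1) * N = (2 * γ + 1) * N + d • (2 * N) by rw [smul_eq_mul]; ring]
    exact M.add_mem hodd (M.nsmul_mem h2 d)

theorem SNstar_eq_layeredSet {N γ g : ℕ} (hN : 2 ≤ N) (hv : 2 * γ < u1star N γ g) :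
    SNstar N γ g = layeredSet N γ (u1star N γ g) (Finset.range N) := by
  apply Set.Subset.antisymm
  · apply closure_le_layeredSet (by omega) _ hv
    · rintro x (rfl | rfl | rfl)
      · exact ⟨0, by omega, 2, by simp, by simp⟩
      · exact ⟨0, by omega, 2 * γ + 1, by simp, by simp⟩
      · exact ⟨1, by omega, 0, by simp, by simp⟩
    · rw [Finset.coe_range]
      exact isLowerSet_Iio N
  · rintro x ⟨j, hj, t, ht, rfl⟩
    refine AddSubmonoid.add_mem _ ?_ (mul_mem_of_even_or_lt (γ := γ)
      (AddSubmonoid.subset_closure (by simp)) (AddSubmonoid.subset_closure (by simp))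
      (ht.resolve_left (by simpa using hj)))
    rw [← smul_eq_mul]
    exact AddSubmonoid.nsmul_mem _ (AddSubmonoid.subset_closure (by simp)) j

theorem SN_eq_layeredSet {N γ g : ℕ} (hN : 2 ≤ N) (hv : 2 * γ < u1N N γ g) :
    SN N γ g = layeredSet N γ (u1N N γ g) {0} := by
  apply Set.Subset.antisymm
  · apply closure_le_layeredSet (by omega) _ hv
    · rintro x (rfl | rfl | rfl | rfl)
      · exact ⟨0, by omega, 2, by simp, by simp⟩
      · exact ⟨0, by omega, 2 * γ + 1, by simp, by simp⟩
      · exact ⟨1, by omega, 0, by simp, by simp⟩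
      · exact ⟨1, by omega, 1, by simp, by simp⟩
    · intro a b hba ha
      simp only [Finset.coe_singleton, Set.mem_singleton_iff] at ha ⊢
      omega
  · rintro x ⟨j, hj, t, ht, rfl⟩
    set v := u1N N γ g
    set M : AddSubmonoid ℕ := AddSubmonoid.closure {2 * N, (2 * γ + 1) * N, v, v + N}
    change j * v + t * N ∈ M
    have h2 : 2 * N ∈ M := AddSubmonoid.subset_closure (by simp)
    have hodd : (2 * γ + 1) * N ∈ M := AddSubmonoid.subset_closure (by simp)
    have hvM : v ∈ M := AddSubmonoid.subset_closure (by simp)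
    have hvN : v + N ∈ M := AddSubmonoid.subset_closure (by simp)
    by_cases hcond : Even t ∨ 2 * γ < t
    · refine M.add_mem ?_ (mul_mem_of_even_or_lt h2 hodd hcond)
      rw [← smul_eq_mul]
      exact M.nsmul_mem hvM j
    · have hj0 : j ≠ 0 := by simpa using ht.resolve_right hcond
      obtain ⟨i, rfl⟩ := Nat.exists_eq_succ_of_ne_zero hj0
      push Not at hcond
      obtain ⟨s, rfl⟩ := Nat.not_even_iff_odd.1 hcond.1
      rw [show i.succ * v + (2 * s + 1) * N = i • v + (v + N) + s • (2 * N) by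
        simp only [smul_eq_mul, Nat.succ_eq_add_one]; ring]
      exact M.add_mem (M.add_mem (M.nsmul_mem hvM i) hvN) (M.nsmul_mem h2 s)

open Finset in
theorem two_mul_sum_range_cast (N : ℕ) : 2 * ∑ j ∈ range N, (j : ℤ) = N * (N - 1) := by
  simpa using two_mul_sum_arith N 0 1

open Finset in
theorem six_mul_sum_range_sq (N : ℕ) :
    6 * ∑ j ∈ range N, (j : ℤ) ^ 2 = N * (N - 1) * (2 * N - 1) := by
  induction N with
  | zero => simp
  | succ n ih =>
    rw [sum_range_succ, mul_add, ih]
    push_cast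
    ring

theorem weight_layeredSet_lt {N γ v : ℕ} (hN : 3 ≤ N) (hγ : 1 ≤ γ) (hv : 10 + 8 * γ ≤ v)
    (hcop : N.Coprime v) (hcop' : N.Coprime (v + 2 * γ)) :
    weight (layeredSet N γ v (Finset.range N)) <
      weight (layeredSet N γ (v + 2 * γ) {0}) := by
  have hN0 : 0 < N := by omega
  have hJ : ({0} : Finset ℕ) ⊆ Finset.range N := by simpa using hN0
  have hP := two_mul_sum_range_cast N
  have hQ := six_mul_sum_range_sq N
  have hg := mul_genus_layeredSet (γ := γ) hN0 hcop subset_rfl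
  have hg' := mul_genus_layeredSet (γ := γ) hN0 hcop' hJ
  have hs := mul_sum_compl_layeredSet (γ := γ) hN0 hcop subset_rfl
  have hs' := mul_sum_compl_layeredSet (γ := γ) hN0 hcop' hJ
  rw [Finset.card_range] at hg hs
  rw [Finset.card_singleton] at hg' hs'
  rw [Finset.sum_singleton] at hs'
  push_cast at hg hg' hs hs'
  have hNz : (N : ℤ) ≠ 0 := by exact_mod_cast hN0.ne'
  have hgenus : (genus (layeredSet N γ v (Finset.range N)) : ℤ) =
      genus (layeredSet N γ (v + 2 * γ) {0}) := by
    apply mul_left_cancel₀ hNz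
    rw [hg, hg']
    linear_combination (-(γ : ℤ)) * hP
  rw [weight, weight, hgenus]
  apply sub_lt_sub_right
  generalize ∑ᶠ ℓ ∈ (layeredSet N γ v (Finset.range N))ᶜ, (ℓ : ℤ) = A at *
  generalize ∑ᶠ ℓ ∈ (layeredSet N γ (v + 2 * γ) {0})ᶜ, (ℓ : ℤ) = B at *
  have key : 6 * N * (B - A) = N * ((N - 1) * γ *
      ((v : ℤ) * (N - 2) + 2 * γ * (2 * N - 1) - 3 * N - 6 * N * γ)) := by
    linear_combination 3 * hs' - 3 * hs + (2 * γ * (v + γ) : ℤ) * hQ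
      - (3 * N * γ + 3 * N * γ * v : ℤ) * hP
  rw [mul_comm (6 : ℤ), mul_assoc] at key
  have key := mul_left_cancel₀ hNz key
  have h1 : (3 : ℤ) ≤ N := by exact_mod_cast hN
  have h2 : (1 : ℤ) ≤ γ := by exact_mod_cast hγ
  have h3 : (10 + 8 * γ : ℤ) ≤ v := by exact_mod_cast hv
  have hpos : 0 < (v : ℤ) * (N - 2) + 2 * γ * (2 * N - 1) - 3 * N - 6 * N * γ := by
    nlinarith
  have : 0 < ((N : ℤ) - 1) * γ *
      ((v : ℤ) * (N - 2) + 2 * γ * (2 * N - 1) - 3 * N - 6 * N * γ) :=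
    mul_pos (mul_pos (by linarith) (by linarith)) hpos
  linarith

/-- for g ≫ γ (with the stated divisibility and residue
conditions), W_{S_N} > W_{S_N*}. -/
theorem stmt19 (N γ : ℕ) (hN : N.Prime) (hN3 : 3 ≤ N) (hγ : 1 ≤ γ) :
    ∃ g₀ : ℕ, ∀ g ≥ g₀,
      (N - 1) / 2 ∣ g → (N - 1) / 2 ∣ γ →
      (2 * (g - γ) / (N - 1)) % N ≠ N - 1 →
      (2 * g / (N - 1)) % N ≠ N - 1 →
      weight (SNstar N γ g) < weight (SN N γ g) := by
  obtain ⟨m, rfl⟩ := hN.odd_of_ne_two (by omega)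
  refine ⟨(2 * m + 1) * (10 + 9 * γ), ?_⟩
  intro g hg hdg hdγ h1 h2
  have hm : 0 < m := by omega
  have hmm : (2 * m + 1 - 1) / 2 = m := by omega
  rw [hmm] at hdg hdγ
  obtain ⟨a, rfl⟩ := hdg
  obtain ⟨c, rfl⟩ := hdγ
  have hdiv : ∀ x, 2 * (m * x) / (2 * m + 1 - 1) = x := by
    intro x
    rw [Nat.add_sub_cancel, ← mul_assoc]
    exact Nat.mul_div_cancel_left x (by omega)
  have hbig : (2 * m + 1) * c + 10 + 8 * (m * c) ≤ a := by
    refine le_of_mul_le_mul_left (a := m) ?_ hm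
    refine le_trans ?_ hg
    nlinarith [Nat.zero_le (m * c), Nat.zero_le (m * (m * c))]
  have hsub1 : m * a - m * c = m * (a - c) := (Nat.mul_sub m a c).symm
  have hsub2 : m * a - (2 * m + 1) * (m * c) = m * (a - (2 * m + 1) * c) := by
    rw [Nat.mul_sub, Nat.mul_left_comm m]
  have hu : u1N (2 * m + 1) (m * c) (m * a) = a - c + 1 := by
    rw [u1N, hsub1, hdiv]
  have hus : u1star (2 * m + 1) (m * c) (m * a) = a - (2 * m + 1) * c + 1 := by
    rw [u1star, hsub2, hdiv]
  rw [hsub1, hdiv] at h1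
  rw [hdiv] at h2
  have hmod : ∀ x, (2 * m + 1) ∣ x + 1 → x % (2 * m + 1) = 2 * m + 1 - 1 := by
    rintro x ⟨k, hk⟩
    obtain ⟨k, rfl⟩ : ∃ l, k = l + 1 := ⟨k - 1, by
      rcases k with _ | k
      · simp at hk
      · simp⟩
    have : x = 2 * m + (2 * m + 1) * k := by linarith
    rw [this, Nat.add_mul_mod_self_left, Nat.mod_eq_of_lt (by omega)]
    omega
  have hexp : (2 * m + 1) * c = 2 * (m * c) + c := by ring
  have hadd : a - c + 1 = (a - (2 * m + 1) * c + 1) + 2 * (m * c) := by omega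
  have hcop : (2 * m + 1).Coprime (a - (2 * m + 1) * c + 1) := by
    refine (Nat.Prime.coprime_iff_not_dvd hN).2 fun hd => h2 (hmod a ?_)
    have := dvd_add hd (dvd_mul_right (2 * m + 1) c)
    rwa [show a - (2 * m + 1) * c + 1 + (2 * m + 1) * c = a + 1 by omega] at this
  have hcop' : (2 * m + 1).Coprime (a - (2 * m + 1) * c + 1 + 2 * (m * c)) := by
    rw [← hadd]
    exact (Nat.Prime.coprime_iff_not_dvd hN).2 fun hd => h1 (hmod _ hd)
  rw [SNstar_eq_layeredSet (by omega) (by omega), SN_eq_layeredSet (by omega) (by omega), hu, hus,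
    hadd]
  exact weight_layeredSet_lt hN3 hγ (by omega) hcop hcop'
end
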